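/- Let C ⊂ 𝔸ⁿ be an affine algebraic curve defined over a number field K, S a finite set of places of K containing all infinite places, and O_S the ring of S-integers. Suppose C has genus 0, C has exactly two points at infinity A and B, conjugate over K with quadratic field of definition L = K(A) = K(B), at least one place v ∈ S splits in L, and C(O_S) contains a non-singular point. Then C(O_S) is infinite. -/

import Mathlib

open IsDedekindDomain NumberField

set_option synthInstance.maxHeartbeats 1000000
set_option maxHeartbeats 2000000

noncomputable section

/-- A place of a number field `K`: either an infinite (archimedean) place or a finite
place, i.e. a height-one prime of the ring of integers. -/
abbrev NFPlace (K : Type) [Field K] [NumberField K] :=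
  NumberField.InfinitePlace K ⊕ IsDedekindDomain.HeightOneSpectrum (NumberField.RingOfIntegers K)

variable (K : Type) [Field K] [NumberField K]

/-- The finite places belonging to a set `S` of places of `K`. -/
def finPart (S : Finset (NFPlace K)) : Set (HeightOneSpectrum (𝓞 K)) :=
  {v | Sum.inr v ∈ S}

/-- The ring of `S`-integers of `K` (as a subalgebra of `K`): the elements of `K` whose
valuation is at most one at every finite place outside `S`. -/
def SIntegers (S : Finset (NFPlace K)) : Subalgebra (𝓞 K) K :=
  (finPart K S).integer K

/-- A place `v` of `K` splits in an extension `L` of `K` if it has (at least) two distinct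
extensions to `L`: for an infinite place, two distinct infinite places of `L` lying above
it; for a finite place, two distinct nonzero prime ideals of `𝓞 L` lying above it. -/
def SplitsIn (L : Type) [Field L] [Algebra K L] : NFPlace K → Prop
  | Sum.inl v => ∃ w₁ w₂ : NumberField.InfinitePlace L, w₁ ≠ w₂ ∧
      w₁.comap (algebraMap K L) = v ∧ w₂.comap (algebraMap K L) = v
  | Sum.inr v => ∃ P Q : Ideal (𝓞 L), P ≠ Q ∧ P.IsPrime ∧ Q.IsPrime ∧ P ≠ ⊥ ∧ Q ≠ ⊥ ∧
      P.comap (algebraMap (𝓞 K) (𝓞 L)) = v.asIdeal ∧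
      Q.comap (algebraMap (𝓞 K) (𝓞 L)) = v.asIdeal

/-- A (geometrically integral) affine algebraic curve in `𝔸ⁿ` defined over `K`, given by
an ideal of polynomials over `K` whose extension to the algebraic closure of `K` is prime
and cuts out a one-dimensional variety. -/
structure AffineCurve (n : ℕ) : Type where
  /-- The ideal of polynomials over `K` vanishing on the curve. -/
  J : Ideal (MvPolynomial (Fin n) K)
  /-- Geometric integrality: the extension of `J` to the algebraic closure is prime. -/
  hprime : (J.map (MvPolynomial.map (algebraMap K (AlgebraicClosure K)))).IsPrime
  /-- The curve is one-dimensional. -/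
  hdim : ringKrullDim (MvPolynomial (Fin n) (AlgebraicClosure K) ⧸
      J.map (MvPolynomial.map (algebraMap K (AlgebraicClosure K)))) = 1

namespace AffineCurve

variable {K} {n : ℕ} (C : AffineCurve K n)

/-- The ideal of the curve over the algebraic closure. -/
def idealBar : Ideal (MvPolynomial (Fin n) (AlgebraicClosure K)) :=
  C.J.map (MvPolynomial.map (algebraMap K (AlgebraicClosure K)))

instance : C.idealBar.IsPrime := C.hprime

/-- The coordinate ring of the curve over the algebraic closure. -/
abbrev CoordRing := MvPolynomial (Fin n) (AlgebraicClosure K) ⧸ C.idealBar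

/-- The function field `K̄(C)` of the curve over the algebraic closure of `K`. -/
abbrev FunField := FractionRing C.CoordRing

/-- The coordinate functions `x₁, …, xₙ`, as elements of the function field. -/
def xcoord (i : Fin n) : C.FunField :=
  algebraMap C.CoordRing C.FunField (Ideal.Quotient.mk C.idealBar (MvPolynomial.X i))

/-- The embedding of the constants `K̄` into the function field. -/
def constMap : AlgebraicClosure K →+* C.FunField :=
  ((algebraMap C.CoordRing C.FunField) : C.CoordRing →+* C.FunField).comp
    ((Ideal.Quotient.mk C.idealBar).comp MvPolynomial.C)

/-- The embedding of `K` into the function field. -/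
def constMapK : K →+* C.FunField := C.constMap.comp (algebraMap K (AlgebraicClosure K))

/-- A place of the curve: a nontrivial valuation subring of `K̄(C)` containing the
constants `K̄`. -/
def IsPlace (V : ValuationSubring C.FunField) : Prop :=
  (∀ a : AlgebraicClosure K, C.constMap a ∈ V) ∧ V ≠ ⊤

/-- A point at infinity of the curve: a place of `K̄(C)` at which at least one of the
coordinate functions admits a pole. -/
def IsPointAtInfinity (V : ValuationSubring C.FunField) : Prop :=
  C.IsPlace V ∧ ∃ i, C.xcoord i ∉ V

/-- The curve has genus `0`: equivalently (the field of constants `K̄` being algebraically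
closed), its function field is a rational function field `K̄(t)`. -/
def GenusZero : Prop :=
  ∃ t : C.FunField, Subfield.closure (Set.range C.constMap ∪ {t}) = ⊤

/-- `σ` is an automorphism of `K̄(C)` over `K(C) = K(x₁, …, xₙ)`. -/
def FixesKC (σ : C.FunField ≃+* C.FunField) : Prop :=
  (∀ a : K, σ (C.constMapK a) = C.constMapK a) ∧ ∀ i, σ (C.xcoord i) = C.xcoord i

/-- A place of `K̄(C)` is defined over `K` if it is fixed by every automorphism of
`K̄(C)` over `K(C)`. -/
def DefinedOverK (V : ValuationSubring C.FunField) : Prop :=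
  ∀ σ : C.FunField ≃+* C.FunField, C.FixesKC σ → V.comap σ.toRingHom = V

/-- Two places of `K̄(C)` are conjugate over `K` if some automorphism of `K̄(C)` over
`K(C)` interchanges them. -/
def ConjugateOverK (A B : ValuationSubring C.FunField) : Prop :=
  ∃ σ : C.FunField ≃+* C.FunField, C.FixesKC σ ∧
    A.comap σ.toRingHom = B ∧ B.comap σ.toRingHom = A

/-- `σ` is an automorphism of `K̄(C)` over `L(C)`, for an intermediate field
`K ⊆ L ⊆ K̄`. -/
def FixesLC (L : IntermediateField K (AlgebraicClosure K)) (σ : C.FunField ≃+* C.FunField) :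
    Prop :=
  (∀ a : L, σ (C.constMap a) = C.constMap a) ∧ ∀ i, σ (C.xcoord i) = C.xcoord i

/-- A place of `K̄(C)` is defined over `L` if it is fixed by every automorphism of
`K̄(C)` over `L(C)`. -/
def DefinedOver (L : IntermediateField K (AlgebraicClosure K))
    (V : ValuationSubring C.FunField) : Prop :=
  ∀ σ : C.FunField ≃+* C.FunField, C.FixesLC L σ → V.comap σ.toRingHom = V

/-- `P` is a `K`-rational point of the curve. -/
def OnCurve (P : Fin n → K) : Prop := ∀ f ∈ C.J, MvPolynomial.eval P f = 0

/-- The set `C(O_S)` of `S`-integral points of the curve: the `K`-rational points all of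
whose coordinates are `S`-integers. -/
def SIntegralPoints (S : Finset (NFPlace K)) : Set (Fin n → K) :=
  {P | C.OnCurve P ∧ ∀ i, P i ∈ SIntegers K S}

/-- `P` is a non-singular point of the curve: `P` lies on the curve and the gradients at
`P` of the polynomials vanishing on the curve span a space of dimension `n - 1`
(Jacobian criterion for a one-dimensional variety). -/
def IsNonsingularPoint (P : Fin n → K) : Prop :=
  C.OnCurve P ∧ Module.finrank K (Submodule.span K
    {g : Fin n → K | ∃ f ∈ C.J, g = fun i => MvPolynomial.eval P (MvPolynomial.pderiv i f)}) =
      n - 1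

end AffineCurve

section Places

open Polynomial IntermediateField

/-- A nontrivial valuation subring of `F` containing the image of the constants `k`. -/
structure IsConstPlace (k : Type*) {F : Type*} [Field k] [Field F] [Algebra k F]
    (V : ValuationSubring F) : Prop where
  const_mem : ∀ a : k, algebraMap k F a ∈ V
  ne_top : V ≠ ⊤

/-- The function `t` takes the value `c` at the place `V`. -/
def TakesValue {k F : Type*} [Field k] [Field F] [Algebra k F]
    (V : ValuationSubring F) (t : F) (c : k) : Prop :=
  V.valuation (t - algebraMap k F c) < 1

/-- A proper ideal of a ring mapping to a field is dominated by a valuation subring. -/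
theorem exists_valuationSubring_dominating {R F : Type*} [CommRing R] [Field F] (f : R →+* F)
    (I : Ideal R) (hI : I ≠ ⊤) (hker : RingHom.ker f ≤ I) :
    ∃ V : ValuationSubring F, (∀ x, f x ∈ V) ∧ ∀ x ∈ I, V.valuation (f x) < 1 := by
  have hne : I.map f.rangeRestrict ≠ ⊤ := by
    intro h
    apply hI
    have h1 : (I.map f.rangeRestrict).comap f.rangeRestrict = I := by
      rw [Ideal.comap_map_of_surjective _ f.rangeRestrict_surjective]
      rw [sup_eq_left]
      intro x hx
      apply hker
      rw [Ideal.mem_comap, Ideal.mem_bot] at hx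
      rw [RingHom.mem_ker]
      exact congrArg Subtype.val hx
    rw [← h1, h, Ideal.comap_top]
  obtain ⟨V, hV, hIV⟩ := Ideal.image_subset_nonunits_valuationSubring _ hne
  refine ⟨V, fun x => hV ⟨x, rfl⟩, fun x hx => ?_⟩
  rw [← ValuationSubring.mem_nonunits_iff]
  exact hIV ⟨f.rangeRestrict x, Ideal.mem_map_of_mem _ hx, rfl⟩

theorem Polynomial.exists_eq_C_mul_X_pow_of_isRoot_imp_eq_zero {k : Type*} [Field k] [IsAlgClosed k]
    (q : k[X]) (h : ∀ c, q.IsRoot c → c = 0) : ∃ (a : k) (m : ℕ), q = C a * X ^ m := by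
  by_cases hq : q = 0
  · exact ⟨0, 0, by simp [hq]⟩
  refine ⟨q.leadingCoeff, q.roots.card, ?_⟩
  have h1 := (IsAlgClosed.splits q).eq_prod_roots
  have h2 : q.roots = Multiset.replicate q.roots.card 0 := by
    rw [Multiset.eq_replicate]
    exact ⟨rfl, fun b hb => h b ((mem_roots hq).1 hb)⟩
  rw [h2] at h1
  simpa using h1

variable {k F : Type*} [Field k] [Field F] [Algebra k F] {V W : ValuationSubring F} {t : F} {c : k}

namespace IsConstPlace

theorem valuation_algebraMap (hV : IsConstPlace k V) {a : k} (ha : a ≠ 0) :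
    V.valuation (algebraMap k F a) = 1 := by
  apply le_antisymm ((V.valuation_le_one_iff _).2 (hV.const_mem a))
  have h := (V.valuation_le_one_iff _).2 (hV.const_mem a⁻¹)
  have h0 : V.valuation (algebraMap k F a) ≠ 0 := by simpa using ha
  rw [map_inv₀, map_inv₀] at h
  exact (inv_le_one₀ (zero_lt_iff.2 h0)).1 h

theorem eq_zero_of_valuation_lt_one (hV : IsConstPlace k V) {a : k}
    (ha : V.valuation (algebraMap k F a) < 1) : a = 0 := by
  by_contra h
  exact ha.ne (hV.valuation_algebraMap h)

theorem mem_of_takesValue (hV : IsConstPlace k V) (h : TakesValue V t c) : t ∈ V := by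
  have h1 : t - algebraMap k F c ∈ V := (V.valuation_le_one_iff _).1 h.le
  simpa using V.add_mem _ _ h1 (hV.const_mem c)

theorem takesValue_unique (hV : IsConstPlace k V) {d : k} (h : TakesValue V t c)
    (h' : TakesValue V t d) : c = d := by
  rw [← sub_eq_zero]
  apply hV.eq_zero_of_valuation_lt_one
  have : algebraMap k F (c - d) = (t - algebraMap k F d) - (t - algebraMap k F c) := by
    rw [map_sub]; ring
  rw [this]
  exact lt_of_le_of_lt (Valuation.map_sub _ _ _) (max_lt h' h)

theorem aeval_mem (hV : IsConstPlace k V) (ht : t ∈ V) (p : k[X]) : aeval t p ∈ V := by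
  induction p using Polynomial.induction_on' with
  | add p q hp hq => rw [map_add]; exact V.add_mem _ _ hp hq
  | monomial n a =>
    rw [aeval_monomial]
    exact V.mul_mem _ _ (hV.const_mem a) (pow_mem ht n)

theorem takesValue_aeval (hV : IsConstPlace k V) (h : TakesValue V t c) (p : k[X]) :
    TakesValue V (aeval t p) (p.eval c) := by
  obtain ⟨q, hq⟩ := X_sub_C_dvd_sub_C_eval (a := c) (p := p)
  have h1 := congrArg (aeval t) hq
  simp only [map_sub, map_mul, aeval_X, aeval_C] at h1
  rw [TakesValue, h1, map_mul]
  exact mul_lt_one_of_lt_of_le h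
    ((V.valuation_le_one_iff _).2 (hV.aeval_mem (hV.mem_of_takesValue h) q))

theorem valuation_eq_one_of_takesValue (hV : IsConstPlace k V) (h : TakesValue V t c)
    (hc : c ≠ 0) : V.valuation t = 1 := by
  have h1 := hV.valuation_algebraMap hc
  have h2 := Valuation.map_add_eq_of_lt_left V.valuation (h.trans_eq h1.symm)
  rwa [add_sub_cancel, h1] at h2

theorem ne_algebraMap (hV : IsConstPlace k V) (hgen : k⟮t⟯ = ⊤) : t ≠ algebraMap k F c := by
  rintro rfl
  apply hV.ne_top
  rw [eq_top_iff]
  intro z _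
  have hz : z ∈ k⟮algebraMap k F c⟯ := hgen ▸ mem_top
  obtain ⟨r, s, rfl⟩ := (mem_adjoin_simple_iff k z).1 hz
  rw [aeval_algebraMap_apply, aeval_algebraMap_apply, ← map_div₀]
  exact hV.const_mem _

theorem le_of_takesValue (hV : IsConstPlace k V) (hW : IsConstPlace k W) (hgen : k⟮t⟯ = ⊤)
    (h : TakesValue V t c) (h' : TakesValue W t c) : V ≤ W := by
  intro z hzV
  have hz : z ∈ k⟮t⟯ := hgen ▸ mem_top
  obtain ⟨r, q, rfl⟩ := (mem_adjoin_simple_iff k z).1 hz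
  by_cases hr : r = 0
  · simp [hr, W.zero_mem]
  by_cases hq : q = 0
  · simp [hq, W.zero_mem]
  obtain ⟨r', hr', hrc⟩ := exists_eq_pow_rootMultiplicity_mul_and_not_dvd r hr c
  obtain ⟨q', hq', hqc⟩ := exists_eq_pow_rootMultiplicity_mul_and_not_dvd q hq c
  rw [dvd_iff_isRoot, IsRoot.def] at hrc hqc
  set a := rootMultiplicity c r
  set b := rootMultiplicity c q
  have key : ∀ U : ValuationSubring F, IsConstPlace k U → TakesValue U t c →
      U.valuation (aeval t r / aeval t q) =
        U.valuation (t - algebraMap k F c) ^ a / U.valuation (t - algebraMap k F c) ^ b := by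
    intro U hU hUc
    have e1 := hU.valuation_eq_one_of_takesValue (hU.takesValue_aeval hUc r') hrc
    have e2 := hU.valuation_eq_one_of_takesValue (hU.takesValue_aeval hUc q') hqc
    rw [hr', hq']
    simp [e1, e2]
  have ht : t - algebraMap k F c ≠ 0 := sub_ne_zero.2 (hV.ne_algebraMap hgen)
  have hpos : ∀ U : ValuationSubring F, 0 < U.valuation (t - algebraMap k F c) := fun U =>
    zero_lt_iff.2 (by simpa using ht)
  rw [← ValuationSubring.valuation_le_one_iff, key W hW h', div_le_one₀ (pow_pos (hpos W) _)]
  rw [← ValuationSubring.valuation_le_one_iff, key V hV h, div_le_one₀ (pow_pos (hpos V) _)] at hzV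
  have hba : b ≤ a := (pow_le_pow_iff_right_of_lt_one₀ (hpos V) h).1 hzV
  exact (pow_le_pow_iff_right_of_lt_one₀ (hpos W) h').2 hba

/-- A place of `k(t)` is determined by the value of `t`. -/
theorem eq_of_takesValue (hV : IsConstPlace k V) (hW : IsConstPlace k W) (hgen : k⟮t⟯ = ⊤)
    (h : TakesValue V t c) (h' : TakesValue W t c) : V = W :=
  le_antisymm (hV.le_of_takesValue hW hgen h h') (hW.le_of_takesValue hV hgen h' h)

theorem exists_takesValue [IsAlgClosed k] (hV : IsConstPlace k V) (hgen : k⟮t⟯ = ⊤)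
    (ht : t ∈ V) : ∃ c : k, TakesValue V t c := by
  by_contra! hcon
  apply hV.ne_top
  have hone : ∀ c : k, V.valuation (t - algebraMap k F c) = 1 := fun c =>
    le_antisymm ((V.valuation_le_one_iff _).2 (sub_mem ht (hV.const_mem c)))
      (not_lt.1 (hcon c))
  have hpoly : ∀ p : k[X], p ≠ 0 → V.valuation (aeval t p) = 1 := by
    intro p hp
    rw [(IsAlgClosed.splits p).eq_prod_roots, map_mul, map_mul, aeval_C,
      hV.valuation_algebraMap (leadingCoeff_ne_zero.2 hp), one_mul, map_multiset_prod,
      map_multiset_prod, Multiset.map_map, Multiset.map_map]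
    apply Multiset.prod_eq_one
    intro x hx
    obtain ⟨c, -, rfl⟩ := Multiset.mem_map.1 hx
    simpa using hone c
  rw [eq_top_iff]
  intro z _
  have hz : z ∈ k⟮t⟯ := hgen ▸ mem_top
  obtain ⟨r, q, rfl⟩ := (mem_adjoin_simple_iff k z).1 hz
  by_cases hr : r = 0
  · simp [hr, V.zero_mem]
  by_cases hq : q = 0
  · simp [hq, V.zero_mem]
  rw [← ValuationSubring.valuation_le_one_iff, map_div₀, hpoly r hr, hpoly q hq, div_one]

theorem aeval_ne_zero [IsAlgClosed k] (hV : IsConstPlace k V) (hgen : k⟮t⟯ = ⊤) {p : k[X]}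
    (hp : p ≠ 0) : aeval t p ≠ 0 := by
  rw [(IsAlgClosed.splits p).eq_prod_roots, map_mul, aeval_C, map_multiset_prod]
  refine mul_ne_zero (by simpa using hp) (Multiset.prod_ne_zero ?_)
  intro h
  rw [Multiset.map_map, Multiset.mem_map] at h
  obtain ⟨c, -, hc⟩ := h
  simp only [Function.comp_apply, map_sub, aeval_X, aeval_C, sub_eq_zero] at hc
  exact hV.ne_algebraMap hgen hc

theorem exists_isConstPlace_takesValue [IsAlgClosed k] (hV : IsConstPlace k V) (hgen : k⟮t⟯ = ⊤)
    (c : k) : ∃ W : ValuationSubring F, IsConstPlace k W ∧ TakesValue W t c := by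
  obtain ⟨W, hW, hWc⟩ := exists_valuationSubring_dominating (aeval t : k[X] →ₐ[k] F).toRingHom
    (Ideal.span {X - C c}) (by
      rw [Ne, Ideal.span_singleton_eq_top]
      exact not_isUnit_X_sub_C c) (by
      intro p hp
      by_cases h0 : p = 0
      · rw [h0]; exact Ideal.zero_mem _
      · exact absurd hp (hV.aeval_ne_zero hgen h0))
  have hval : TakesValue W t c := by
    simpa [TakesValue] using hWc (X - C c) (Ideal.mem_span_singleton_self _)
  refine ⟨W, ⟨fun a => by simpa using hW (C a), ?_⟩, hval⟩
  rintro rfl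
  have h0 : t - algebraMap k F c ≠ 0 := sub_ne_zero.2 (hV.ne_algebraMap hgen)
  have h1 : (⊤ : ValuationSubring F).valuation (t - algebraMap k F c)⁻¹ ≤ 1 :=
    (ValuationSubring.valuation_le_one_iff _ _).2 (ValuationSubring.mem_top _)
  rw [map_inv₀] at h1
  exact absurd h1 (not_le.2 ((one_lt_inv₀ (zero_lt_iff.2 (by simpa using h0))).2 hval))

/-- A function on the projective line regular outside `0` and `∞` is a Laurent polynomial. -/
theorem exists_mul_pow_eq_aeval [IsAlgClosed k] (hV : IsConstPlace k V) (hgen : k⟮t⟯ = ⊤) {x : F}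
    (hx : ∀ (W : ValuationSubring F) (c : k), IsConstPlace k W → TakesValue W t c → c ≠ 0 → x ∈ W) :
    ∃ (p : k[X]) (m : ℕ), x * t ^ m = aeval t p := by
  have hz : x ∈ k⟮t⟯ := hgen ▸ mem_top
  obtain ⟨r, q, hrq⟩ := (mem_adjoin_simple_iff k x).1 hz
  by_cases hq : q = 0
  · exact ⟨0, 0, by simp [hrq, hq]⟩
  obtain ⟨q', r', g, hrel, hq', hr'⟩ := UniqueFactorizationMonoid.exists_reduced_factors q hq r
  have hcop : IsCoprime r' q' := hrel.isCoprime.symm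
  have hg : g ≠ 0 := fun h => hq (by rw [← hq', h, zero_mul])
  have hq0 : q' ≠ 0 := fun h => hq (by rw [← hq', h, mul_zero])
  have hxr : x * aeval t q' = aeval t r' := by
    rw [hrq, ← hr', ← hq']
    have := hV.aeval_ne_zero hgen hg
    have := hV.aeval_ne_zero hgen hq0
    rw [map_mul, map_mul]
    field_simp
  obtain ⟨a, m, ham⟩ := Polynomial.exists_eq_C_mul_X_pow_of_isRoot_imp_eq_zero q' (by
    intro c hc
    by_contra hc0
    obtain ⟨W, hW, hWc⟩ := hV.exists_isConstPlace_takesValue hgen c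
    have h1 := hW.takesValue_aeval hWc q'
    have h2 := hW.takesValue_aeval hWc r'
    have h3 : TakesValue W (aeval t r') (0 : k) := by
      rw [TakesValue, map_zero, sub_zero, ← hxr, map_mul]
      rw [hc.eq_zero, TakesValue, map_zero, sub_zero] at h1
      exact (mul_le_of_le_one_left' ((W.valuation_le_one_iff _).2 (hx W c hW hWc hc0))).trans_lt h1
    have h4 := hW.takesValue_unique h2 h3
    obtain ⟨u, w, huw⟩ := hcop
    have := congrArg (eval c) huw
    simp [h4, hc.eq_zero] at this)
  have ha : a ≠ 0 := fun h => hq0 (by rw [ham, h, C_0, zero_mul])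
  refine ⟨C a⁻¹ * r', m, ?_⟩
  rw [map_mul, aeval_C, ← hxr, ham, map_mul, aeval_C, map_pow, aeval_X, map_inv₀]
  have : algebraMap k F a ≠ 0 := by simpa using ha
  field_simp

theorem exists_eq_algebraMap_mul_zpow [IsAlgClosed k] (hV : IsConstPlace k V) (hgen : k⟮t⟯ = ⊤)
    {x : F} (hx0 : x ≠ 0)
    (hx : ∀ (W : ValuationSubring F) (c : k), IsConstPlace k W → TakesValue W t c → c ≠ 0 →
      W.valuation x = 1) :
    ∃ (a : k) (e : ℤ), a ≠ 0 ∧ x = algebraMap k F a * t ^ e := by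
  obtain ⟨p, m, hpm⟩ := hV.exists_mul_pow_eq_aeval hgen (x := x)
    (fun W c hW hWc hc => (W.valuation_le_one_iff _).1 (hx W c hW hWc hc).le)
  have ht : t ≠ 0 := by simpa using hV.ne_algebraMap hgen (c := 0)
  obtain ⟨a, j, haj⟩ := Polynomial.exists_eq_C_mul_X_pow_of_isRoot_imp_eq_zero p (by
    intro c hc
    by_contra hc0
    obtain ⟨W, hW, hWc⟩ := hV.exists_isConstPlace_takesValue hgen c
    have h1 := hW.takesValue_aeval hWc p
    rw [← hpm, hc.eq_zero, TakesValue, map_zero, sub_zero, map_mul, map_pow, hx W c hW hWc hc0,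
      hW.valuation_eq_one_of_takesValue hWc hc0] at h1
    simp at h1)
  have hxe : x = algebraMap k F a * t ^ ((j : ℤ) - m) := by
    rw [zpow_sub₀ ht, zpow_natCast, zpow_natCast, ← mul_div_assoc, eq_div_iff (pow_ne_zero _ ht),
      hpm, haj]
    simp
  refine ⟨a, (j : ℤ) - m, ?_, hxe⟩
  rintro rfl
  apply hx0
  simpa using hxe

end IsConstPlace

end Places

section Divisors

open Polynomial IntermediateField

variable {k F : Type*} [Field k] [Field F] [Algebra k F]

theorem ValuationSubring.comap_valuation_lt_one_iff {F' : Type*} [Field F'] (V : ValuationSubring F)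
    (f : F' →+* F) (x : F') : (V.comap f).valuation x < 1 ↔ V.valuation (f x) < 1 := by
  rw [← mem_nonunits_iff, ← mem_nonunits_iff, mem_nonunits_iff_or, mem_nonunits_iff_or,
    mem_comap, map_inv₀, map_eq_zero]

theorem ValuationSubring.comap_ringEquiv_injective (σ : F ≃+* F) :
    Function.Injective fun V : ValuationSubring F => V.comap σ.toRingHom := by
  intro V W h
  ext x
  have h1 := SetLike.ext_iff.1 h (σ.symm x)
  simpa using h1

theorem IsConstPlace.comap {V : ValuationSubring F} (hV : IsConstPlace k V) {σ : F ≃+* F}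
    {τ : k → k} (hσ : ∀ a, σ (algebraMap k F a) = algebraMap k F (τ a)) :
    IsConstPlace k (V.comap σ.toRingHom) := by
  refine ⟨fun a => ?_, fun h => hV.ne_top (ValuationSubring.comap_ringEquiv_injective σ ?_)⟩
  · rw [ValuationSubring.mem_comap]
    simpa [hσ] using hV.const_mem (τ a)
  · simp only [h]
    ext x
    simp

theorem takesValue_comap_iff {V : ValuationSubring F} {σ : F ≃+* F}
    {τ : k → k} (hσ : ∀ a, σ (algebraMap k F a) = algebraMap k F (τ a)) (t : F) (c : k) :
    TakesValue (V.comap σ.toRingHom) t c ↔ TakesValue V (σ t) (τ c) := by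
  rw [TakesValue, TakesValue, ValuationSubring.comap_valuation_lt_one_iff]
  simp [hσ]

theorem adjoin_simple_eq_top_of_mem {s t : F} (ht : k⟮t⟯ = ⊤) (h : t ∈ k⟮s⟯) : k⟮s⟯ = ⊤ := by
  rw [eq_top_iff, ← ht, adjoin_simple_le_iff]
  exact h

/-- `s` generates `F` over `k`, with its pole at the place `A` and its zero at the place `B`. -/
structure IsPoleZeroGenerator (k : Type*) {F : Type*} [Field k] [Field F] [Algebra k F]
    (A B : ValuationSubring F) (s : F) : Prop where
  isConstPlace_pole : IsConstPlace k A
  isConstPlace_zero : IsConstPlace k B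
  adjoin_eq_top : k⟮s⟯ = ⊤
  not_mem_pole : s ∉ A
  takesValue_zero : TakesValue B s (0 : k)

theorem IsConstPlace.exists_isPoleZeroGenerator [IsAlgClosed k] {A B : ValuationSubring F}
    (hA : IsConstPlace k A) (hB : IsConstPlace k B) (hAB : A ≠ B) {t : F} (ht : k⟮t⟯ = ⊤) :
    ∃ s, IsPoleZeroGenerator k A B s := by
  obtain ⟨u, hu, huA⟩ : ∃ u : F, k⟮u⟯ = ⊤ ∧ u ∉ A := by
    by_cases htA : t ∈ A
    · obtain ⟨c, hc⟩ := hA.exists_takesValue ht htA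
      refine ⟨(t - algebraMap k F c)⁻¹, adjoin_simple_eq_top_of_mem ht ?_, ?_⟩
      · have h1 := inv_mem (mem_adjoin_simple_self k (t - algebraMap k F c)⁻¹)
        rw [inv_inv] at h1
        simpa using add_mem h1 (IntermediateField.algebraMap_mem _ c)
      · rw [TakesValue, ← ValuationSubring.mem_nonunits_iff,
          ValuationSubring.mem_nonunits_iff_or] at hc
        exact hc.resolve_left (sub_ne_zero.2 (hA.ne_algebraMap ht))
    · exact ⟨t, ht, htA⟩
  have pole_inv : ∀ V : ValuationSubring F, u ∉ V → TakesValue V u⁻¹ (0 : k) := by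
    intro V hV
    rw [TakesValue, map_zero, sub_zero, ← ValuationSubring.mem_nonunits_iff,
      ValuationSubring.inv_mem_nonunits_iff]
    exact Or.inr hV
  have huB : u ∈ B := by
    by_contra huB
    refine hAB (hA.eq_of_takesValue hB (adjoin_simple_eq_top_of_mem hu ?_)
      (pole_inv A huA) (pole_inv B huB))
    simpa using inv_mem (mem_adjoin_simple_self k u⁻¹)
  obtain ⟨c, hc⟩ := hB.exists_takesValue hu huB
  refine ⟨u - algebraMap k F c, hA, hB, adjoin_simple_eq_top_of_mem hu ?_, ?_, ?_⟩
  · simpa using add_mem (mem_adjoin_simple_self k (u - algebraMap k F c))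
      (IntermediateField.algebraMap_mem _ c)
  · intro h
    exact huA (by simpa using A.add_mem _ _ h (hA.const_mem c))
  · simpa [TakesValue] using hc

namespace IsPoleZeroGenerator

variable {A B V : ValuationSubring F} {s : F}

theorem ne_zero (h : IsPoleZeroGenerator k A B s) : s ≠ 0 := fun h0 =>
  h.not_mem_pole (h0 ▸ A.zero_mem)

theorem valuation_zero_lt_one (h : IsPoleZeroGenerator k A B s) : B.valuation s < 1 := by
  simpa [TakesValue] using h.takesValue_zero

theorem inv_takesValue_pole (h : IsPoleZeroGenerator k A B s) : TakesValue A s⁻¹ (0 : k) := by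
  rw [TakesValue, map_zero, sub_zero, ← ValuationSubring.mem_nonunits_iff,
    ValuationSubring.inv_mem_nonunits_iff]
  exact Or.inr h.not_mem_pole

theorem ne_of_takesValue (h : IsPoleZeroGenerator k A B s) {c : k}
    (hc : TakesValue V s c) (hc0 : c ≠ 0) : V ≠ A ∧ V ≠ B := by
  constructor
  · rintro rfl
    exact h.not_mem_pole (h.isConstPlace_pole.mem_of_takesValue hc)
  · rintro rfl
    exact hc0 (h.isConstPlace_zero.takesValue_unique hc h.takesValue_zero)

theorem exists_takesValue [IsAlgClosed k] (h : IsPoleZeroGenerator k A B s)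
    (hV : IsConstPlace k V) (hVA : V ≠ A) (hVB : V ≠ B) :
    ∃ c : k, c ≠ 0 ∧ TakesValue V s c := by
  have hsV : s ∈ V := by
    by_contra hsV
    refine hVA (hV.eq_of_takesValue h.isConstPlace_pole (t := s⁻¹) (c := (0 : k))
      (adjoin_simple_eq_top_of_mem h.adjoin_eq_top ?_) ?_ h.inv_takesValue_pole)
    · simpa using inv_mem (mem_adjoin_simple_self k s⁻¹)
    · rw [TakesValue, map_zero, sub_zero, ← ValuationSubring.mem_nonunits_iff,
        ValuationSubring.inv_mem_nonunits_iff]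
      exact Or.inr hsV
  obtain ⟨c, hc⟩ := hV.exists_takesValue h.adjoin_eq_top hsV
  refine ⟨c, ?_, hc⟩
  rintro rfl
  exact hVB (hV.eq_of_takesValue h.isConstPlace_zero h.adjoin_eq_top hc h.takesValue_zero)

theorem algebraMap_mul (h : IsPoleZeroGenerator k A B s) {a : k} (ha : a ≠ 0) :
    IsPoleZeroGenerator k A B (algebraMap k F a * s) := by
  have ha' : algebraMap k F a ≠ 0 := by simpa using ha
  refine ⟨h.isConstPlace_pole, h.isConstPlace_zero,
    adjoin_simple_eq_top_of_mem h.adjoin_eq_top ?_, ?_, ?_⟩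
  · have h1 := mul_mem (IntermediateField.algebraMap_mem k⟮algebraMap k F a * s⟯ a⁻¹)
      (mem_adjoin_simple_self k (algebraMap k F a * s))
    rwa [map_inv₀, inv_mul_cancel_left₀ ha'] at h1
  · intro h1
    have h2 := A.mul_mem _ _ (h.isConstPlace_pole.const_mem a⁻¹) h1
    rw [map_inv₀, inv_mul_cancel_left₀ ha'] at h2
    exact h.not_mem_pole h2
  · simp [TakesValue, h.isConstPlace_zero.valuation_algebraMap ha, h.valuation_zero_lt_one]

/-- An automorphism preserving the places away from the pole and the zero of `s` maps `s` to a
monomial. -/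
theorem exists_apply_eq [IsAlgClosed k] (h : IsPoleZeroGenerator k A B s)
    {σ : F ≃+* F} {τ : k → k}
    (hσ : ∀ a, σ (algebraMap k F a) = algebraMap k F (τ a))
    (hperm : ∀ V : ValuationSubring F, V ≠ A → V ≠ B →
      V.comap σ.toRingHom ≠ A ∧ V.comap σ.toRingHom ≠ B) :
    ∃ (a : k) (e : ℤ), a ≠ 0 ∧ σ s = algebraMap k F a * s ^ e := by
  refine h.isConstPlace_pole.exists_eq_algebraMap_mul_zpow h.adjoin_eq_top
    (by simpa using h.ne_zero) ?_
  intro W c hW hWc hc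
  obtain ⟨hWA, hWB⟩ := h.ne_of_takesValue hWc hc
  obtain ⟨hA, hB⟩ := hperm W hWA hWB
  obtain ⟨d, hd, hWd⟩ := h.exists_takesValue (hW.comap hσ) hA hB
  have hτd : τ d ≠ 0 := by
    intro h0
    have := hσ d
    rw [h0, map_zero] at this
    simp [hd] at this
  exact hW.valuation_eq_one_of_takesValue ((takesValue_comap_iff hσ _ _).1 hWd) hτd

theorem zpow_eq_algebraMap_mul (h : IsPoleZeroGenerator k A B s) {a : k} {n : ℤ}
    (ha : a ≠ 0) (hn : s = algebraMap k F a * s ^ n) :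
    n = 1 := by
  have hv := congrArg B.valuation hn
  rw [map_mul, h.isConstPlace_zero.valuation_algebraMap ha, one_mul, map_zpow₀] at hv
  have hpos : 0 < B.valuation s := zero_lt_iff.2 (by simpa using h.ne_zero)
  have := zpow_right_injective₀ hpos h.valuation_zero_lt_one.ne (a₁ := n) (a₂ := 1)
    (by simpa using hv.symm)
  exact this

theorem exists_apply_eq_or [IsAlgClosed k] (h : IsPoleZeroGenerator k A B s)
    {σ : F ≃+* F} {τ : k ≃ k}
    (hσ : ∀ a, σ (algebraMap k F a) = algebraMap k F (τ a))
    (hperm : ∀ V : ValuationSubring F, V ≠ A ∧ V ≠ B ↔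
      V.comap σ.toRingHom ≠ A ∧ V.comap σ.toRingHom ≠ B) :
    ∃ (a : k), a ≠ 0 ∧ (σ s = algebraMap k F a * s ∨ σ s = algebraMap k F a * s⁻¹) := by
  obtain ⟨a, e, ha, hae⟩ := h.exists_apply_eq hσ fun V hVA hVB => (hperm V).1 ⟨hVA, hVB⟩
  have hσ' : ∀ a, σ.symm (algebraMap k F a) = algebraMap k F (τ.symm a) := by
    intro a
    rw [RingEquiv.symm_apply_eq, hσ, Equiv.apply_symm_apply]
  obtain ⟨b, f, hb, hbf⟩ := h.exists_apply_eq hσ' (by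
    intro V hVA hVB
    rw [hperm]
    have : (V.comap σ.symm.toRingHom).comap σ.toRingHom = V := by
      ext x; simp
    rw [this]
    exact ⟨hVA, hVB⟩)
  have hτb : τ b ≠ 0 := by
    intro h0
    have := hσ b
    rw [h0, map_zero] at this
    simp [hb] at this
  have hs := congrArg σ hbf
  rw [RingEquiv.apply_symm_apply, map_mul, map_zpow₀, hσ, hae, mul_zpow, ← mul_assoc,
    ← map_zpow₀, ← map_mul, ← zpow_mul] at hs
  have hef := h.zpow_eq_algebraMap_mul (mul_ne_zero hτb (zpow_ne_zero _ ha)) hs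
  refine ⟨a, ha, ?_⟩
  rcases Int.eq_one_or_neg_one_of_mul_eq_one hef with rfl | rfl
  · left; simpa using hae
  · right; simpa using hae

theorem apply_eq_self [IsAlgClosed k] (h : IsPoleZeroGenerator k A B s)
    {V₁ : ValuationSubring F} (hV₁ : IsConstPlace k V₁) (hone : TakesValue V₁ s (1 : k))
    {σ : F ≃+* F} {τ : k ≃ k} (hτ : τ 1 = 1)
    (hσ : ∀ a, σ (algebraMap k F a) = algebraMap k F (τ a))
    (hA : A.comap σ.toRingHom = A) (hB : B.comap σ.toRingHom = B)
    (hV : V₁.comap σ.toRingHom = V₁) : σ s = s := by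
  have inj := ValuationSubring.comap_ringEquiv_injective σ
  obtain ⟨a, ha, h1⟩ := h.exists_apply_eq_or hσ (by
    intro V
    have eA := inj.ne_iff (x := V) (y := A)
    have eB := inj.ne_iff (x := V) (y := B)
    simp only [hA, hB] at eA eB
    rw [eA, eB])
  have hval : TakesValue V₁ (σ s) (1 : k) := by
    rw [← hτ, ← takesValue_comap_iff hσ, hV]
    exact hone
  rcases h1 with h1 | h1
  · rw [h1] at hval
    have h2 := hV₁.takesValue_aeval hone (C a * X)
    simp only [map_mul, aeval_C, aeval_X, eval_mul, eval_C, eval_X, mul_one] at h2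
    have := hV₁.takesValue_unique h2 hval
    simpa [this] using h1
  · exfalso
    apply h.not_mem_pole
    rw [← hA, ValuationSubring.mem_comap]
    change σ s ∈ A
    rw [h1]
    exact A.mul_mem _ _ (h.isConstPlace_pole.const_mem a)
      (h.isConstPlace_pole.mem_of_takesValue h.inv_takesValue_pole)

theorem apply_eq_inv [IsAlgClosed k] (h : IsPoleZeroGenerator k A B s)
    {V₁ : ValuationSubring F} (hV₁ : IsConstPlace k V₁) (hone : TakesValue V₁ s (1 : k))
    {σ : F ≃+* F} {τ : k ≃ k} (hτ : τ 1 = 1)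
    (hσ : ∀ a, σ (algebraMap k F a) = algebraMap k F (τ a))
    (hA : A.comap σ.toRingHom = B) (hB : B.comap σ.toRingHom = A)
    (hV : V₁.comap σ.toRingHom = V₁) : σ s = s⁻¹ := by
  have inj := ValuationSubring.comap_ringEquiv_injective σ
  obtain ⟨a, ha, h1⟩ := h.exists_apply_eq_or hσ (by
    intro V
    have eA := inj.ne_iff (x := V) (y := A)
    have eB := inj.ne_iff (x := V) (y := B)
    simp only [hA, hB] at eA eB
    rw [eA, eB, and_comm])
  have hval : TakesValue V₁ (σ s) (1 : k) := by
    rw [← hτ, ← takesValue_comap_iff hσ, hV]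
    exact hone
  rcases h1 with h1 | h1
  · exfalso
    apply h.not_mem_pole
    rw [← hB, ValuationSubring.mem_comap]
    change σ s ∈ B
    rw [h1]
    exact B.mul_mem _ _ (h.isConstPlace_zero.const_mem a)
      (h.isConstPlace_zero.mem_of_takesValue h.takesValue_zero)
  · rw [h1] at hval
    have hs := hV₁.valuation_eq_one_of_takesValue hone one_ne_zero
    have h2 : TakesValue V₁ (algebraMap k F a) (1 : k) := by
      have e : algebraMap k F a - algebraMap k F 1 =
          s * (algebraMap k F a * s⁻¹ - algebraMap k F 1) + (s - algebraMap k F 1) := by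
        have := h.ne_zero
        rw [map_one]; field_simp; ring
      rw [TakesValue, e]
      refine (Valuation.map_add _ _ _).trans_lt (max_lt ?_ hone)
      rw [map_mul, hs, one_mul]
      exact hval
    have h3 : a = 1 := by
      rw [← sub_eq_zero]
      apply hV₁.eq_zero_of_valuation_lt_one
      rw [map_sub]
      exact h2
    simpa [h3] using h1

end IsPoleZeroGenerator

end Divisors

namespace MvPolynomial

/-- The first-order Taylor expansion of a polynomial at a point. -/
theorem sub_taylor_mem_sq {ι R : Type*} [Fintype ι] [CommRing R] (P : ι → R)
    (f : MvPolynomial ι R) :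
    f - C (eval P f) - ∑ i, C (eval P (pderiv i f)) * (X i - C (P i)) ∈
      Ideal.span (Set.range fun i => (X i - C (P i) : MvPolynomial ι R)) ^ 2 := by
  classical
  set 𝔪 := Ideal.span (Set.range fun i => (X i - C (P i) : MvPolynomial ι R)) with h𝔪
  have hX : ∀ i, (X i - C (P i) : MvPolynomial ι R) ∈ 𝔪 := fun i => Ideal.subset_span ⟨i, rfl⟩
  induction f using MvPolynomial.induction_on with
  | C a => simp
  | add p q hp hq =>
    have := add_mem hp hq
    convert this using 1
    simp only [map_add, add_mul, Finset.sum_add_distrib]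
    ring
  | mul_X p j hp =>
    have h1 := Ideal.mul_mem_left _ (X j) hp
    have h2 : (X j - C (P j)) * ∑ i, C (eval P (pderiv i p)) * (X i - C (P i)) ∈ 𝔪 ^ 2 := by
      rw [pow_two]
      exact Ideal.mul_mem_mul (hX j) (Ideal.sum_mem _ fun i _ => Ideal.mul_mem_left _ _ (hX i))
    convert add_mem h1 h2 using 1
    have h3 : ∑ i, C (eval P (pderiv i (p * X j))) * (X i - C (P i)) =
        C (P j) * ∑ i, C (eval P (pderiv i p)) * (X i - C (P i)) +
          C (eval P p) * (X j - C (P j)) := by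
      have h4 : ∀ i, C (eval P (pderiv i (p * X j))) * (X i - C (P i)) =
          C (P j) * (C (eval P (pderiv i p)) * (X i - C (P i))) +
            if i = j then C (eval P p) * (X i - C (P i)) else 0 := by
        intro i
        rw [pderiv_mul, pderiv_X]
        split_ifs with hij
        · subst hij
          simp
          ring
        · simp [Ne.symm hij]
          ring
      rw [Finset.sum_congr rfl fun i _ => h4 i, Finset.sum_add_distrib, ← Finset.mul_sum]
      simp
    rw [h3]
    simp only [map_mul, eval_X]
    ring

theorem sub_C_eval_mem {ι R : Type*} [Fintype ι] [CommRing R] (P : ι → R)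
    (f : MvPolynomial ι R) :
    f - C (eval P f) ∈ Ideal.span (Set.range fun i => (X i - C (P i) : MvPolynomial ι R)) := by
  have h1 := Ideal.pow_le_self two_ne_zero (sub_taylor_mem_sq P f)
  have h2 := Ideal.sum_mem (Ideal.span (Set.range fun i => (X i - C (P i) : MvPolynomial ι R)))
    (t := Finset.univ) (f := fun i => C (eval P (pderiv i f)) * (X i - C (P i)))
    fun i _ => Ideal.mul_mem_left _ _ (Ideal.subset_span ⟨i, rfl⟩)
  simpa using add_mem h1 h2

theorem dvd_total_of_jacobian {ι k O : Type*} [Fintype ι] [DecidableEq ι] [Field k]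
    [CommRing O] [IsDomain O] [IsLocalRing O] [IsNoetherianRing O]
    (I : Ideal (MvPolynomial ι k)) (P : ι → k) (hP : ∀ f ∈ I, eval P f = 0) (j : ι)
    (hj : ∀ i, ∃ l : k, ∃ f ∈ I, (fun r => eval P (pderiv r f)) =
      (Pi.single i 1 - l • Pi.single j 1 : ι → k))
    (φ : MvPolynomial ι k →+* O) (hφI : ∀ f ∈ I, φ f = 0)
    (hM : IsLocalRing.maximalIdeal O =
      (Ideal.span (Set.range fun i => (X i - C (P i) : MvPolynomial ι k))).map φ) :
    ∀ u v : O, u ∣ v ∨ v ∣ u := by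
  set 𝔪 := Ideal.span (Set.range fun i => (X i - C (P i) : MvPolynomial ι k)) with h𝔪
  have hprin : IsLocalRing.maximalIdeal O ≤ Ideal.span {φ (X j - C (P j))} := by
    refine Submodule.le_of_le_smul_of_le_jacobson_bot (R := O) (M := O)
      (I := IsLocalRing.maximalIdeal O) (N' := IsLocalRing.maximalIdeal O)
      (IsNoetherian.noetherian _) (IsLocalRing.maximalIdeal_le_jacobson _) ?_
    rw [smul_eq_mul, ← pow_two]
    nth_rewrite 1 [hM]
    rw [Ideal.map_le_iff_le_comap, h𝔪, Ideal.span_le]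
    rintro _ ⟨i, rfl⟩
    rw [SetLike.mem_coe, Ideal.mem_comap]
    obtain ⟨l, f, hf, hgrad⟩ := hj i
    have h1 := sub_taylor_mem_sq P f
    have h2 : ∑ r, C (eval P (pderiv r f)) * (X r - C (P r)) =
        (X i - C (P i)) - C l * (X j - C (P j)) := by
      have h3 : ∀ r, C (eval P (pderiv r f)) * (X r - C (P r)) =
          (if r = i then (X r - C (P r)) else 0) -
            (if r = j then C l * (X r - C (P r)) else 0) := by
        intro r
        rw [congrFun hgrad r]
        by_cases h1 : r = i <;> by_cases h2 : r = j <;> simp [Pi.single_apply, h1, h2] <;>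
          split_ifs <;> simp [sub_mul]
      rw [Finset.sum_congr rfl fun r _ => h3 r, Finset.sum_sub_distrib]
      simp
    rw [h2, hP f hf, C_0, sub_zero] at h1
    have h4 := Ideal.mem_map_of_mem φ h1
    rw [Ideal.map_pow, ← hM, map_sub, hφI f hf, zero_sub, map_sub, map_mul] at h4
    have h5 := add_mem (Ideal.mem_sup_left (T := IsLocalRing.maximalIdeal O ^ 2)
      (Ideal.mul_mem_left _ (φ (C l)) (Ideal.mem_span_singleton_self (φ (X j - C (P j))))))
      (Ideal.mem_sup_right (S := Ideal.span {φ (X j - C (P j))}) (neg_mem h4))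
    simpa using h5
  have hpr : (IsLocalRing.maximalIdeal O).IsPrincipal := by
    refine ⟨φ (X j - C (P j)), le_antisymm hprin ?_⟩
    change Ideal.span _ ≤ _
    rw [Ideal.span_singleton_le_iff_mem, hM]
    exact Ideal.mem_map_of_mem _ (Ideal.subset_span ⟨j, rfl⟩)
  have : ValuationRing O :=
    ((tfae_of_isNoetherianRing_of_isLocalRing_of_isDomain O).out 1 4).2 hpr
  exact ValuationRing.dvd_total

/-- The local ring of an integral affine scheme at a point with one-dimensional Zariski cotangent
space is a valuation ring. -/
theorem exists_mul_sub_mul_mem_of_jacobian {ι k : Type*} [Fintype ι] [DecidableEq ι] [Field k]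
    (I : Ideal (MvPolynomial ι k)) [hI : I.IsPrime] (P : ι → k) (hP : ∀ f ∈ I, eval P f = 0) (j : ι)
    (hj : ∀ i, ∃ l : k, ∃ f ∈ I, (fun r => eval P (pderiv r f)) =
      (Pi.single i 1 - l • Pi.single j 1 : ι → k))
    (a b : MvPolynomial ι k) :
    ∃ c d, eval P d ≠ 0 ∧ (a * d - b * c ∈ I ∨ b * d - a * c ∈ I) := by
  let ev : MvPolynomial ι k ⧸ I →+* k := Ideal.Quotient.lift I (eval P) hP
  let m : Ideal (MvPolynomial ι k ⧸ I) := RingHom.ker ev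
  have hm : m.IsPrime := RingHom.ker_isPrime ev
  let O := Localization.AtPrime m
  let φ : MvPolynomial ι k →+* O := (algebraMap (MvPolynomial ι k ⧸ I) O).comp (Ideal.Quotient.mk I)
  have hφI : ∀ f ∈ I, φ f = 0 := fun f hf => by
    simp [φ, Ideal.Quotient.eq_zero_iff_mem.2 hf]
  set 𝔪 := Ideal.span (Set.range fun i => (X i - C (P i) : MvPolynomial ι k)) with h𝔪
  have : IsDomain O := IsLocalization.isDomain_localization m.primeCompl_le_nonZeroDivisors
  have : IsNoetherianRing O := IsLocalization.isNoetherianRing m.primeCompl O inferInstance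
  have hmk : m = 𝔪.map (Ideal.Quotient.mk I) := by
    apply le_antisymm
    · intro r hr
      obtain ⟨f, rfl⟩ := Ideal.Quotient.mk_surjective r
      have hf : eval P f = 0 := hr
      have := sub_C_eval_mem P f
      rw [hf, C_0, sub_zero] at this
      exact Ideal.mem_map_of_mem _ this
    · rw [Ideal.map_le_iff_le_comap, h𝔪, Ideal.span_le]
      rintro _ ⟨i, rfl⟩
      change eval P _ = 0
      simp
  have hM : IsLocalRing.maximalIdeal O = 𝔪.map φ := by
    rw [← Ideal.map_map, ← hmk]
    exact (IsLocalization.AtPrime.map_eq_maximalIdeal m O).symm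
  have htotal : ∀ u v : O, u ∣ v ∨ v ∣ u := dvd_total_of_jacobian I P hP j hj φ hφI hM
  have key : ∀ a b : MvPolynomial ι k, φ b ∣ φ a → ∃ c d, eval P d ≠ 0 ∧ a * d - b * c ∈ I := by
    rintro a b ⟨y, hy⟩
    obtain ⟨c', ⟨d', hd'⟩, rfl⟩ := IsLocalization.exists_mk'_eq m.primeCompl y
    obtain ⟨c, rfl⟩ := Ideal.Quotient.mk_surjective c'
    obtain ⟨d, rfl⟩ := Ideal.Quotient.mk_surjective d'
    refine ⟨c, d, fun h => hd' h, ?_⟩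
    rw [← Ideal.Quotient.eq_zero_iff_mem, map_sub, sub_eq_zero]
    apply IsLocalization.injective O m.primeCompl_le_nonZeroDivisors
    have h1 := IsLocalization.mk'_spec O (Ideal.Quotient.mk I c) ⟨Ideal.Quotient.mk I d, hd'⟩
    simp only [map_mul]
    change φ a * φ d = φ b * φ c
    rw [hy]
    change _ * φ d = φ c at h1
    rw [mul_assoc, h1]
  rcases htotal (φ b) (φ a) with h | h
  · obtain ⟨c, d, hd, h1⟩ := key a b h
    exact ⟨c, d, hd, Or.inl h1⟩
  · obtain ⟨c, d, hd, h1⟩ := key b a h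
    exact ⟨c, d, hd, Or.inr h1⟩

end MvPolynomial

section NonsingularPlace

open MvPolynomial

variable {k F ι : Type*} [Field k] [Field F] [Algebra k F] {V W : ValuationSubring F}
  {x : ι → F} {P : ι → k}

theorem IsConstPlace.mvAeval_mem (hV : IsConstPlace k V) (hx : ∀ i, x i ∈ V)
    (f : MvPolynomial ι k) : aeval x f ∈ V := by
  induction f using MvPolynomial.induction_on with
  | C a => simpa using hV.const_mem a
  | add p q hp hq => rw [map_add]; exact V.add_mem _ _ hp hq
  | mul_X p i hp => rw [map_mul, aeval_X]; exact V.mul_mem _ _ hp (hx i)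

theorem IsConstPlace.takesValue_mvAeval (hV : IsConstPlace k V)
    (hP : ∀ i, TakesValue V (x i) (P i)) (f : MvPolynomial ι k) :
    TakesValue V (aeval x f) (eval P f) := by
  induction f using MvPolynomial.induction_on with
  | C a => simp [TakesValue]
  | add p q hp hq =>
    rw [TakesValue, map_add, map_add, map_add, add_sub_add_comm]
    exact (Valuation.map_add _ _ _).trans_lt (max_lt hp hq)
  | mul_X p i hp =>
    have e : aeval x (p * X i) - algebraMap k F (eval P (p * X i)) =
        (aeval x p - algebraMap k F (eval P p)) * x i +
          algebraMap k F (eval P p) * (x i - algebraMap k F (P i)) := by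
      simp only [map_mul, aeval_X, eval_X]; ring
    rw [TakesValue, e]
    refine (Valuation.map_add _ _ _).trans_lt (max_lt ?_ ?_)
    · rw [map_mul]
      exact mul_lt_one_of_lt_of_le hp
        ((V.valuation_le_one_iff _).2 (hV.mem_of_takesValue (hP i)))
    · rw [map_mul]
      exact (mul_le_of_le_one_left' ((V.valuation_le_one_iff _).2 (hV.const_mem _))).trans_lt (hP i)

/-- There is only one place above a point whose local ring is a valuation ring. -/
theorem IsConstPlace.le_of_point (hV : IsConstPlace k V) (hW : IsConstPlace k W)
    (hfrac : ∀ z : F, ∃ a b : MvPolynomial ι k, z = aeval x a / aeval x b)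
    (hval : ∀ a b : MvPolynomial ι k, ∃ c d, eval P d ≠ 0 ∧
      (aeval x (a * d - b * c) = 0 ∨ aeval x (b * d - a * c) = 0))
    (hVP : ∀ i, TakesValue V (x i) (P i)) (hWP : ∀ i, TakesValue W (x i) (P i)) : V ≤ W := by
  intro z hz
  obtain ⟨a, b, rfl⟩ := hfrac z
  by_cases ha : aeval x a = 0
  · simp [ha, W.zero_mem]
  by_cases hb : aeval x b = 0
  · simp [hb, W.zero_mem]
  obtain ⟨c, d, hd, h⟩ := hval a b
  have hdV := hV.valuation_eq_one_of_takesValue (hV.takesValue_mvAeval hVP d) hd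
  have hdW := hW.valuation_eq_one_of_takesValue (hW.takesValue_mvAeval hWP d) hd
  have hd0 : aeval x d ≠ 0 := by
    intro h0; rw [h0, map_zero] at hdW; exact zero_ne_one hdW
  have hcW := hW.mvAeval_mem (fun i => hW.mem_of_takesValue (hWP i)) c
  rcases h with h | h
  · rw [map_sub, map_mul, map_mul, sub_eq_zero] at h
    have hz' : aeval x a / aeval x b = aeval x c / aeval x d := by
      rw [div_eq_div_iff hb hd0, h, mul_comm]
    rw [hz', ← ValuationSubring.valuation_le_one_iff, map_div₀, hdW, div_one,
      ValuationSubring.valuation_le_one_iff]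
    exact hcW
  · rw [map_sub, map_mul, map_mul, sub_eq_zero] at h
    have hc0 : aeval x c ≠ 0 := by
      intro h0
      rw [h0, mul_zero] at h
      exact (mul_ne_zero hb hd0) h
    have hz' : aeval x a / aeval x b = aeval x d / aeval x c := by
      rw [div_eq_div_iff hb hc0, ← h, mul_comm]
    rw [hz'] at hz ⊢
    rw [← ValuationSubring.valuation_le_one_iff, map_div₀, hdV, one_div] at hz
    have hc : eval P c ≠ 0 := by
      intro h0
      have h1 := hV.takesValue_mvAeval hVP c
      rw [h0, TakesValue, map_zero, sub_zero] at h1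
      exact absurd hz (not_le.2 ((one_lt_inv₀ (zero_lt_iff.2 (by simpa using hc0))).2 h1))
    have h1 := hW.valuation_eq_one_of_takesValue (hW.takesValue_mvAeval hWP c) hc
    rw [← ValuationSubring.valuation_le_one_iff, map_div₀, hdW, h1, div_one]

end NonsingularPlace

section ConjugatePair

open scoped Pointwise

/-- An infinite place of `K` with two extensions to the Galois extension `L` yields a unit of `L`
none of whose positive powers agrees with the same power of one of its conjugates. -/
theorem NumberField.exists_unit_pow_ne_of_comap_eq {K L : Type} [Field K] [Field L]
    [NumberField L] [Algebra K L] [IsGalois K L] {w₁ w₂ : InfinitePlace L} (hne : w₁ ≠ w₂)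
    (hw : w₁.comap (algebraMap K L) = w₂.comap (algebraMap K L)) :
    ∃ (a : (𝓞 L)ˣ) (g : Gal(L/K)), ∀ k : ℕ, k ≠ 0 →
      ((a : 𝓞 L) : L) ^ k ≠ g ((a : 𝓞 L) : L) ^ k := by
  obtain ⟨σ, hσ⟩ := InfinitePlace.exists_smul_eq_of_comap_eq hw
  obtain ⟨a, ha⟩ := Units.dirichletUnitTheorem.exists_unit L w₁
  have ha0 : ((a : 𝓞 L) : L) ≠ 0 := by
    simp
  refine ⟨a, σ.symm, fun k hk h => ?_⟩
  have h₂ : w₂ ((a : 𝓞 L) : L) < 1 := by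
    by_contra! h1
    exact absurd (ha w₂ hne.symm) (not_lt.2 (Real.log_nonneg h1))
  have h₁ : 1 < w₁ ((a : 𝓞 L) : L) := by
    by_contra! h1
    have hsum := Units.sum_mult_mul_log a
    refine absurd hsum (ne_of_lt ?_)
    rw [← Finset.sum_const_zero (s := (Finset.univ : Finset (InfinitePlace L)))]
    refine Finset.sum_lt_sum (fun w _ => ?_) ⟨w₂, Finset.mem_univ _, ?_⟩
    · refine mul_nonpos_of_nonneg_of_nonpos (by positivity) ?_
      rcases eq_or_ne w w₁ with rfl | hw'
      · exact Real.log_nonpos (apply_nonneg _ _) h1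
      · exact (ha w hw').le
    · exact mul_neg_of_pos_of_neg (by exact_mod_cast w₂.mult_pos) (ha w₂ hne.symm)
  have := congrArg w₁ h
  rw [map_pow, map_pow, ← InfinitePlace.smul_apply, hσ] at this
  exact absurd this (ne_of_gt ((pow_lt_one₀ (apply_nonneg _ _) h₂ hk).trans
    (one_lt_pow₀ h₁ hk)))

variable {K}

/-- A prime of `K` with two primes of the Galois extension `L` above it yields an integer of `L`
none of whose positive powers agrees with the same power of one of its conjugates, and which lies
in no prime of `L` but one above the given prime. -/
theorem NumberField.exists_integer_pow_ne_of_comap_eq {L : Type} [Field L] [NumberField L]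
    [Algebra K L] [IsGalois K L] {p : Ideal (𝓞 K)} {P Q : Ideal (𝓞 L)} [P.IsPrime] [Q.IsPrime]
    (hne : P ≠ Q) (hP0 : P ≠ ⊥) (hP : P.comap (algebraMap (𝓞 K) (𝓞 L)) = p)
    (hQ : Q.comap (algebraMap (𝓞 K) (𝓞 L)) = p) :
    ∃ (a : 𝓞 L) (g : Gal(L/K)), a ≠ 0 ∧ (∀ k : ℕ, k ≠ 0 → (a : L) ^ k ≠ g (a : L) ^ k) ∧
      ∀ W : Ideal (𝓞 L), W.IsPrime → a ∈ W → P ≤ W := by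
  have : P.LiesOver p := ⟨hP.symm⟩
  have : Q.LiesOver p := ⟨hQ.symm⟩
  have : P.IsMaximal := Ring.DimensionLEOne.maximalOfPrime hP0 inferInstance
  obtain ⟨σ, hσ⟩ := Ideal.exists_smul_eq_of_isGaloisGroup p P Q Gal(L/K)
  have hPm : P ∈ nonZeroDivisors (Ideal (𝓞 L)) := mem_nonZeroDivisors_of_ne_zero hP0
  set h := Fintype.card (ClassGroup (𝓞 L)) with hh
  have hh0 : h ≠ 0 := Fintype.card_ne_zero
  have hprinc : Submodule.IsPrincipal (P ^ h) := by
    rw [← ClassGroup.mk0_eq_one_iff (pow_mem hPm h)]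
    have : (⟨P ^ h, pow_mem hPm h⟩ : nonZeroDivisors (Ideal (𝓞 L))) = ⟨P, hPm⟩ ^ h := rfl
    rw [this, map_pow, hh, pow_card_eq_one]
  obtain ⟨a, ha⟩ := hprinc
  replace ha : P ^ h = Ideal.span {a} := ha
  have haP : a ∈ P := Ideal.pow_le_self hh0 (ha ▸ Ideal.mem_span_singleton_self a)
  have hmem : ∀ W : Ideal (𝓞 L), W.IsPrime → a ∈ W → P ≤ W := fun W hW haW =>
    hW.le_of_pow_le (n := h) (ha ▸ (Ideal.span_singleton_le_iff_mem _).2 haW)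
  refine ⟨a, σ⁻¹, ?_, fun k hk hak => ?_, hmem⟩
  · rintro rfl
    refine pow_ne_zero h hP0 ?_
    simpa using ha
  · have hak' : a ^ k = (σ⁻¹ • a) ^ k := by
      apply RingOfIntegers.coe_injective
      rw [map_pow, map_pow]
      exact hak
    have : σ⁻¹ • a ∈ P :=
      Ideal.IsPrime.mem_of_pow_mem inferInstance k (hak' ▸ Ideal.pow_mem_of_mem P haP k
        (Nat.pos_of_ne_zero hk))
    rw [← Ideal.mem_pointwise_smul_iff_inv_smul_mem, hσ] at this
    have hPQ := hmem Q inferInstance this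
    exact hne (Ideal.IsMaximal.eq_of_le inferInstance (Ideal.IsPrime.ne_top inferInstance) hPQ)

/-- In a quadratic extension, the norm is the product of the two conjugates. -/
theorem Algebra.algebraMap_norm_eq_mul_of_finrank_eq_two {k E : Type*} [Field k] [Field E]
    [Algebra k E] [IsGalois k E] (h2 : Module.finrank k E = 2) {g : Gal(E/k)} (hg : g ≠ 1)
    (x : E) : algebraMap k E (Algebra.norm k x) = x * g x := by
  classical
  have : FiniteDimensional k E := Module.finite_of_finrank_pos (by omega)
  rw [Algebra.norm_eq_prod_automorphisms]
  have hcard : Fintype.card Gal(E/k) = 2 := by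
    rw [← Nat.card_eq_fintype_card, IsGalois.card_aut_eq_finrank, h2]
  have : (Finset.univ : Finset Gal(E/k)) = {1, g} := by
    symm
    apply Finset.eq_univ_of_card
    rw [Finset.card_pair hg.symm, hcard]
  rw [this, Finset.prod_pair hg.symm]
  rfl

theorem mem_SIntegers_iff {S : Finset (NFPlace K)} {x : K} :
    x ∈ SIntegers K S ↔ ∀ v : HeightOneSpectrum (𝓞 K), Sum.inr v ∉ S → v.valuation K x ≤ 1 :=
  Iff.rfl

/-- The ring of `S`-integers is integrally closed. -/
theorem mem_SIntegers_of_isIntegral {S : Finset (NFPlace K)} {x : K}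
    (hx : IsIntegral (SIntegers K S) x) : x ∈ SIntegers K S := by
  rw [mem_SIntegers_iff]
  intro v hv
  obtain ⟨p, hp, hpx⟩ := hx
  have hle : ∀ y : SIntegers K S, (y : K) ∈ (v.valuation K).integer := fun y =>
    mem_SIntegers_iff.1 y.2 v hv
  let f : SIntegers K S →+* (v.valuation K).integer :=
    (SIntegers K S).val.toRingHom.codRestrict _ hle
  have : IsIntegral (v.valuation K).integer x := ⟨p.map f, hp.map f, by
    rw [Polynomial.eval₂_map]; exact hpx⟩
  exact (Valuation.Integers.mem_of_integral (Valuation.integer.integers (v.valuation K)) this)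

/-- If a place of `S` splits in the quadratic extension `L`, there is an integer of `L` whose
norm to `K` is an `S`-unit and whose positive powers all differ from their conjugates. -/
theorem exists_integer_norm_isUnit_of_splitsIn {S : Finset (NFPlace K)} {L : Type} [Field L]
    [NumberField L] [Algebra K L] [IsGalois K L] (h2 : Module.finrank K L = 2)
    (hsplit : ∃ v ∈ S, SplitsIn K L v) :
    ∃ (a : 𝓞 L) (g : Gal(L/K)), a ≠ 0 ∧ (∀ k : ℕ, k ≠ 0 → (a : L) ^ k ≠ g (a : L) ^ k) ∧
      ∃ u ∈ SIntegers K S, algebraMap K L u * (a * g a) = 1 := by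
  obtain ⟨v | v, hvS, hv⟩ := hsplit
  · obtain ⟨w₁, w₂, hne, h₁, h₂⟩ := hv
    obtain ⟨a, g, hg⟩ := exists_unit_pow_ne_of_comap_eq hne (h₁.trans h₂.symm)
    have hg1 : g ≠ 1 := by
      rintro rfl
      exact hg 1 one_ne_zero rfl
    refine ⟨a, g, a.ne_zero, hg, (RingOfIntegers.norm K ((a⁻¹ : (𝓞 L)ˣ) : 𝓞 L) : 𝓞 K),
      (SIntegers K S).algebraMap_mem _, ?_⟩
    rw [← Algebra.algebraMap_norm_eq_mul_of_finrank_eq_two h2 hg1, ← map_mul]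
    have : ((RingOfIntegers.norm K ((a⁻¹ : (𝓞 L)ˣ) : 𝓞 L) : 𝓞 K) : K) *
        ((RingOfIntegers.norm K (a : 𝓞 L) : 𝓞 K) : K) = 1 := by
      rw [← map_mul (algebraMap (𝓞 K) K), ← map_mul, Units.inv_mul, map_one, map_one]
    rw [RingOfIntegers.coe_norm K (a : 𝓞 L)] at this
    erw [this, map_one]
  · obtain ⟨P, Q, hne, hP, hQ, hP0, hQ0, hPv, hQv⟩ := hv
    obtain ⟨a, g, ha0, hg, hW⟩ := exists_integer_pow_ne_of_comap_eq hne hP0 hPv hQv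
    have hg1 : g ≠ 1 := by
      rintro rfl
      exact hg 1 one_ne_zero rfl
    have hnorm := Algebra.algebraMap_norm_eq_mul_of_finrank_eq_two h2 hg1 (a : L)
    have hnorm0 : Algebra.norm K (a : L) ≠ 0 := by
      rw [Algebra.norm_ne_zero_iff]
      exact RingOfIntegers.coe_ne_zero_iff.2 ha0
    refine ⟨a, g, ha0, hg, (Algebra.norm K (a : L))⁻¹, ?_, ?_⟩
    · rw [mem_SIntegers_iff]
      intro v' hv'
      have hnot : RingOfIntegers.norm K a ∉ v'.asIdeal := by
        intro hmem
        have := v'.isMaximal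
        obtain ⟨W, hWmax, hWv⟩ := Ideal.exists_ideal_over_maximal_of_isIntegral (S := 𝓞 L)
          v'.asIdeal (by
            rw [(RingHom.injective_iff_ker_eq_bot _).1
              (FaithfulSMul.algebraMap_injective (𝓞 K) (𝓞 L))]
            exact bot_le)
        have hmemW : a * g • a ∈ W := by
          rw [← hWv, Ideal.mem_comap] at hmem
          convert hmem using 1
          apply RingOfIntegers.ext
          refine hnorm.symm.trans ?_
          rw [← RingOfIntegers.coe_norm]
          rfl
        have key : ∀ W' : Ideal (𝓞 L), W'.IsPrime →
            W'.comap (algebraMap (𝓞 K) (𝓞 L)) = v'.asIdeal → a ∉ W' := by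
          intro W' hW' hW'v haW'
          have hle : v.asIdeal ≤ v'.asIdeal := by
            rw [← hPv, ← hW'v]
            exact Ideal.comap_mono (hW W' hW' haW')
          have := v.isMaximal
          have : v = v' := HeightOneSpectrum.ext
            (Ideal.IsMaximal.eq_of_le v.isMaximal v'.isPrime.ne_top hle)
          exact hv' (this ▸ hvS)
        rcases hWmax.isPrime.mem_or_mem hmemW with h | h
        · exact key W hWmax.isPrime hWv h
        · rw [← Ideal.mem_inv_pointwise_smul_iff] at h
          refine key (g⁻¹ • W) (Ideal.IsPrime.smul (H := hWmax.isPrime) _) ?_ h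
          ext x
          rw [← hWv, Ideal.mem_comap, Ideal.mem_comap, Ideal.mem_inv_pointwise_smul_iff,
            smul_algebraMap]
      have hval := (HeightOneSpectrum.valuation_eq_one_iff_notMem (K := K) v').2 hnot
      rw [map_inv₀, ← RingOfIntegers.coe_norm]
      exact (congrArg _ hval).le.trans inv_one.le
    · rw [← hnorm, ← map_mul, inv_mul_cancel₀ hnorm0, map_one]

/-- Two integers of a number field have, modulo a nonzero integer, a common period for their
powers. -/
theorem NumberField.exists_dvd_pow_mul_pow_sub_one {L : Type} [Field L] [NumberField L]
    (a b : 𝓞 L) {d : ℤ} (hd : d ≠ 0) :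
    ∃ i N : ℕ, N ≠ 0 ∧ (d : 𝓞 L) ∣ a ^ i * (a ^ N - 1) ∧ (d : 𝓞 L) ∣ b ^ i * (b ^ N - 1) := by
  have hI : Ideal.span {(d : 𝓞 L)} ≠ ⊥ := by
    rw [Ne, Ideal.span_singleton_eq_bot]
    exact_mod_cast hd
  have : Finite (𝓞 L ⧸ Ideal.span {(d : 𝓞 L)}) := Ideal.finiteQuotientOfFreeOfNeBot _ hI
  let q := Ideal.Quotient.mk (Ideal.span {(d : 𝓞 L)})
  obtain ⟨i, j, hij, hq⟩ : ∃ i j : ℕ, i < j ∧ (q a ^ i, q b ^ i) = (q a ^ j, q b ^ j) := by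
    obtain ⟨i, j, hne, h⟩ := Finite.exists_ne_map_eq_of_infinite
      (fun i : ℕ => (q a ^ i, q b ^ i))
    rcases lt_or_gt_of_ne hne with h' | h'
    · exact ⟨i, j, h', h⟩
    · exact ⟨j, i, h', h.symm⟩
  obtain ⟨N, rfl⟩ := Nat.exists_eq_add_of_lt hij
  have key : ∀ x : 𝓞 L, q x ^ i = q x ^ (i + N + 1) → (d : 𝓞 L) ∣ x ^ i * (x ^ (N + 1) - 1) := by
    intro x hx
    rw [← Ideal.mem_span_singleton, ← Ideal.Quotient.eq_zero_iff_mem]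
    have : x ^ i * (x ^ (N + 1) - 1) = x ^ (i + N + 1) - x ^ i := by ring
    rw [this, map_sub, map_pow, map_pow]
    exact sub_eq_zero.2 hx.symm
  exact ⟨i, N + 1, N.succ_ne_zero, key a (Prod.ext_iff.1 hq).1, key b (Prod.ext_iff.1 hq).2⟩

/-- If a place of `S` splits in the quadratic extension `L`, there is an `S`-unit of `L` of
infinite order inverted by the nontrivial automorphisms, together with powers of it congruent
to `1` modulo any given integer. -/
theorem exists_norm_one_unit_of_splitsIn {S : Finset (NFPlace K)} {L : Type} [Field L]
    [Algebra K L] (h2 : Module.finrank K L = 2) (hsplit : ∃ v ∈ S, SplitsIn K L v) :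
    ∃ η : L, η ≠ 0 ∧ (∀ g : Gal(L/K), g ≠ 1 → g η = η⁻¹) ∧ (∀ k : ℕ, k ≠ 0 → η ^ k ≠ 1) ∧
      IsIntegral (SIntegers K S) η ∧ IsIntegral (SIntegers K S) η⁻¹ ∧
      ∀ d : ℤ, d ≠ 0 → ∃ N : ℕ, N ≠ 0 ∧ ∃ y : L, IsIntegral (SIntegers K S) y ∧
        η ^ N - 1 = d * y := by
  have : FiniteDimensional K L := Module.finite_of_finrank_pos (by omega)
  have : NumberField L := NumberField.of_module_finite K L
  have : Algebra.IsQuadraticExtension K L := ⟨h2⟩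
  have : IsGalois K L := inferInstance
  obtain ⟨a, g, ha0, hne, u, hu, hua⟩ := exists_integer_norm_isUnit_of_splitsIn h2 hsplit
  have hg1 : g ≠ 1 := by
    rintro rfl
    exact hne 1 one_ne_zero rfl
  have hg : ∀ g' : Gal(L/K), g' ≠ 1 → g' = g := by
    have hcard : Nat.card Gal(L/K) = 2 := by rw [IsGalois.card_aut_eq_finrank, h2]
    intro g' hg'
    obtain ⟨x, y, hxy, huniv⟩ := Nat.card_eq_two_iff.1 hcard
    have h1 := huniv.symm ▸ Set.mem_univ (1 : Gal(L/K))
    have h2 := huniv.symm ▸ Set.mem_univ g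
    have h3 := huniv.symm ▸ Set.mem_univ g'
    simp only [Set.mem_insert_iff, Set.mem_singleton_iff] at h1 h2 h3
    grind
  have hgg : ∀ x : L, g (g x) = x := by
    intro x
    have : g * g = 1 := by
      by_contra h
      exact hg1 (mul_eq_left.1 (hg _ h))
    exact DFunLike.congr_fun this x
  set b : 𝓞 L := g • a with hb
  have hbL : (b : L) = g a := rfl
  rw [← hbL] at hua
  have haL : (a : L) ≠ 0 := RingOfIntegers.coe_ne_zero_iff.2 ha0
  have hbL0 : (b : L) ≠ 0 := by
    rw [hbL]
    exact (map_ne_zero g).2 haL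
  have hintegral : ∀ x : 𝓞 L, IsIntegral (SIntegers K S) (x : L) := fun x =>
    ((RingOfIntegers.isIntegral_coe x).tower_top (A := 𝓞 K)).tower_top
  have hui : IsIntegral (SIntegers K S) (algebraMap K L u) :=
    isIntegral_algebraMap (R := SIntegers K S) (x := ⟨u, hu⟩)
  have hainv : IsIntegral (SIntegers K S) (a : L)⁻¹ := by
    have : (a : L)⁻¹ = algebraMap K L u * b :=
      inv_eq_of_mul_eq_one_left (by rw [← hua]; ring)
    rw [this]
    exact hui.mul (hintegral b)
  have hbinv : IsIntegral (SIntegers K S) (b : L)⁻¹ := by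
    have : (b : L)⁻¹ = algebraMap K L u * a :=
      inv_eq_of_mul_eq_one_left (by rw [← hua]; ring)
    rw [this]
    exact hui.mul (hintegral a)
  refine ⟨a / b, div_ne_zero haL hbL0, fun g' hg' => ?_, fun k hk h => ?_, ?_, ?_, fun d hd => ?_⟩
  · rw [hg g' hg', map_div₀, hbL, hgg, inv_div]
  · rw [div_pow, div_eq_one_iff_eq (pow_ne_zero _ hbL0)] at h
    exact hne k hk h
  · rw [div_eq_mul_inv]
    exact (hintegral a).mul hbinv
  · rw [inv_div, div_eq_mul_inv]
    exact (hintegral b).mul hainv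
  · obtain ⟨i, N, hN, ⟨y, hy⟩, z, hz⟩ := exists_dvd_pow_mul_pow_sub_one a b hd
    refine ⟨N, hN, ((a : L)⁻¹ ^ i * y - (b : L)⁻¹ ^ i * z) * (b : L)⁻¹ ^ N,
      (((hainv.pow i).mul (hintegral y)).sub ((hbinv.pow i).mul (hintegral z))).mul (hbinv.pow N), ?_⟩
    have hy' := congrArg (algebraMap (𝓞 L) L) hy
    have hz' := congrArg (algebraMap (𝓞 L) L) hz
    simp only [map_mul, map_pow, map_sub, map_one, map_intCast] at hy' hz'
    change (a : L) ^ i * ((a : L) ^ N - 1) = d * (y : L) at hy'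
    change (b : L) ^ i * ((b : L) ^ N - 1) = d * (z : L) at hz'
    have e : (a : L) ^ N - b ^ N = d * ((a : L)⁻¹ ^ i * y - (b : L)⁻¹ ^ i * z) := by
      rw [mul_sub, mul_left_comm _ _ (y : L), mul_left_comm _ _ (z : L), ← hy', ← hz', inv_pow,
        inv_pow, inv_mul_cancel_left₀ (pow_ne_zero _ haL), inv_mul_cancel_left₀ (pow_ne_zero _ hbL0)]
      ring
    rw [← mul_assoc, ← e, div_pow, sub_mul, ← mul_pow, ← mul_pow, mul_inv_cancel₀ hbL0, one_pow,
      mul_pow, inv_pow, div_eq_mul_inv]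

end ConjugatePair

namespace AffineCurve

open MvPolynomial IntermediateField

variable {k : Type} [Field k] {n : ℕ} (C : AffineCurve k n)

theorem algebraMap_eq_constMap (a : AlgebraicClosure k) :
    algebraMap (AlgebraicClosure k) C.FunField a = C.constMap a := rfl

theorem aeval_xcoord (f : MvPolynomial (Fin n) (AlgebraicClosure k)) :
    aeval C.xcoord f = algebraMap C.CoordRing C.FunField (Ideal.Quotient.mk C.idealBar f) := by
  induction f using MvPolynomial.induction_on with
  | C a => rw [aeval_C]; rfl
  | add p q hp hq => simp only [map_add, hp, hq]
  | mul_X p i hp => rw [map_mul, hp, aeval_X, map_mul, map_mul]; rfl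

theorem aeval_xcoord_eq_zero {f : MvPolynomial (Fin n) (AlgebraicClosure k)}
    (hf : f ∈ C.idealBar) : aeval C.xcoord f = 0 := by
  rw [aeval_xcoord, Ideal.Quotient.eq_zero_iff_mem.2 hf, map_zero]

theorem isConstPlace_of_isPlace {V : ValuationSubring C.FunField} (h : C.IsPlace V) :
    IsConstPlace (AlgebraicClosure k) V := ⟨h.1, h.2⟩

theorem isPlace_of_isConstPlace {V : ValuationSubring C.FunField}
    (h : IsConstPlace (AlgebraicClosure k) V) : C.IsPlace V := ⟨h.1, h.2⟩

theorem exists_eq_aeval_div_aeval (z : C.FunField) :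
    ∃ a b : MvPolynomial (Fin n) (AlgebraicClosure k), z = aeval C.xcoord a / aeval C.xcoord b := by
  obtain ⟨x, y, -, rfl⟩ := IsFractionRing.div_surjective (A := C.CoordRing) z
  obtain ⟨a, rfl⟩ := Ideal.Quotient.mk_surjective x
  obtain ⟨b, rfl⟩ := Ideal.Quotient.mk_surjective y
  exact ⟨a, b, by rw [aeval_xcoord, aeval_xcoord]⟩

variable {C} in
theorem GenusZero.exists_adjoin_eq_top (h : C.GenusZero) :
    ∃ t : C.FunField, (AlgebraicClosure k)⟮t⟯ = ⊤ := by
  obtain ⟨t, ht⟩ := h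
  refine ⟨t, ?_⟩
  rw [eq_top_iff]
  intro x _
  have hx : x ∈ Subfield.closure (Set.range C.constMap ∪ {t}) := ht ▸ Subfield.mem_top x
  exact hx

/-- The automorphism of `k̄(C)` over `k(C)` that extends an automorphism of `k̄` over `k`. -/
theorem exists_extension (τ : Gal(AlgebraicClosure k/k)) :
    ∃ σ : C.FunField ≃+* C.FunField, (∀ a, σ (C.constMap a) = C.constMap (τ a)) ∧
      ∀ i, σ (C.xcoord i) = C.xcoord i := by
  let e : MvPolynomial (Fin n) (AlgebraicClosure k) ≃+* MvPolynomial (Fin n) (AlgebraicClosure k) :=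
    MvPolynomial.mapEquiv (Fin n) τ.toRingEquiv
  have he : C.idealBar = C.idealBar.map (e : _ →+* _) := by
    rw [idealBar, Ideal.map_map]
    congr 1
    ext x
    · simp [e]
    · simp [e]
  let σ : C.FunField ≃+* C.FunField :=
    IsFractionRing.ringEquivOfRingEquiv (Ideal.quotientEquiv C.idealBar C.idealBar e he)
  have hσ : ∀ f, σ (algebraMap C.CoordRing C.FunField (Ideal.Quotient.mk C.idealBar f)) =
      algebraMap C.CoordRing C.FunField (Ideal.Quotient.mk C.idealBar (e f)) := by
    intro f
    simp only [σ, IsFractionRing.ringEquivOfRingEquiv_algebraMap, Ideal.quotientEquiv_mk]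
  refine ⟨σ, fun a => ?_, fun i => ?_⟩
  · refine (hσ (MvPolynomial.C a)).trans ?_
    have : e (MvPolynomial.C a) = MvPolynomial.C (τ a) := by simp [e]
    rw [this]
    rfl
  · refine (hσ (X i)).trans ?_
    have : e (X i) = X i := by simp [e]
    rw [this]
    rfl

variable {C} in
/-- An automorphism of `k̄(C)` over `k(C)` restricts to an automorphism of `k̄` over `k`. -/
theorem FixesKC.exists_restriction {σ : C.FunField ≃+* C.FunField} (h : C.FixesKC σ) :
    ∃ τ : Gal(AlgebraicClosure k/k), ∀ a, σ (C.constMap a) = C.constMap (τ a) := by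
  let σ' : C.FunField ≃ₐ[k] C.FunField := AlgEquiv.ofRingEquiv (f := σ) h.1
  refine ⟨σ'.restrictNormal (AlgebraicClosure k), fun a => ?_⟩
  exact (σ'.restrictNormal_commutes (AlgebraicClosure k) a).symm

variable {C} in
theorem OnCurve.eval_eq_zero {P : Fin n → k} (hP : C.OnCurve P)
    {f : MvPolynomial (Fin n) (AlgebraicClosure k)} (hf : f ∈ C.idealBar) :
    eval (fun i => algebraMap k (AlgebraicClosure k) (P i)) f = 0 := by
  have hle : C.idealBar ≤
      RingHom.ker (eval (fun i => algebraMap k (AlgebraicClosure k) (P i))) := by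
    rw [idealBar, Ideal.map_le_iff_le_comap]
    intro g hg
    rw [Ideal.mem_comap, RingHom.mem_ker, eval_map]
    have := MvPolynomial.eval₂_comp_left (algebraMap k (AlgebraicClosure k)) (RingHom.id k) P g
    rw [RingHom.comp_id] at this
    refine this.symm.trans ?_
    rw [MvPolynomial.eval₂_id, hP g hg, map_zero]
  exact hle hf

variable {C} in
/-- At a nonsingular point the differentials of the coordinate functions are all multiples of
one of them. -/
theorem IsNonsingularPoint.exists_gradient_eq (hn : n ≠ 0) {P : Fin n → k}
    (hP : C.IsNonsingularPoint P) : ∃ j, ∀ i, ∃ l : k, ∃ f ∈ C.J,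
      (fun r => eval P (pderiv r f)) = (Pi.single i 1 - l • Pi.single j 1 : Fin n → k) := by
  obtain ⟨hon, hrank⟩ := hP
  set W := Submodule.span k
    {g : Fin n → k | ∃ f ∈ C.J, g = fun i => eval P (pderiv i f)} with hW
  have hmem : ∀ w ∈ W, ∃ f ∈ C.J, (fun r => eval P (pderiv r f)) = w := by
    intro w hw
    induction hw using Submodule.span_induction with
    | mem x hx => exact hx.imp fun f hf => ⟨hf.1, hf.2.symm⟩
    | zero => exact ⟨0, C.J.zero_mem, by ext; simp⟩
    | add x y _ _ hx hy =>
      obtain ⟨f, hf, rfl⟩ := hx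
      obtain ⟨g, hg, rfl⟩ := hy
      exact ⟨f + g, C.J.add_mem hf hg, by ext; simp⟩
    | smul a x _ hx =>
      obtain ⟨f, hf, rfl⟩ := hx
      exact ⟨MvPolynomial.C a * f, C.J.mul_mem_left _ hf, by ext; simp⟩
  obtain ⟨j, hj⟩ : ∃ j, (Pi.single j 1 : Fin n → k) ∉ W := by
    by_contra! hall
    have htop : W = ⊤ := by
      rw [eq_top_iff, ← (Pi.basisFun k (Fin n)).span_eq, Submodule.span_le]
      rintro _ ⟨i, rfl⟩
      simpa using hall i
    rw [htop, finrank_top, Module.finrank_fin_fun] at hrank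
    omega
  have hsup : W ⊔ Submodule.span k {(Pi.single j 1 : Fin n → k)} = ⊤ := by
    apply Submodule.eq_top_of_finrank_eq
    have hlt : W < W ⊔ Submodule.span k {(Pi.single j 1 : Fin n → k)} := by
      refine lt_of_le_of_ne le_sup_left fun h => hj ?_
      rw [h]
      exact Submodule.mem_sup_right (Submodule.mem_span_singleton_self _)
    have h1 := Submodule.finrank_lt_finrank_of_lt hlt
    have h2 := Submodule.finrank_le (W ⊔ Submodule.span k {(Pi.single j 1 : Fin n → k)})
    rw [Module.finrank_fin_fun] at h2 ⊢
    omega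
  refine ⟨j, fun i => ?_⟩
  have hi : (Pi.single i 1 : Fin n → k) ∈ W ⊔ Submodule.span k {(Pi.single j 1 : Fin n → k)} :=
    hsup ▸ Submodule.mem_top
  obtain ⟨w, hw, z, hz, hwz⟩ := Submodule.mem_sup.1 hi
  obtain ⟨l, rfl⟩ := Submodule.mem_span_singleton.1 hz
  obtain ⟨f, hf, hfw⟩ := hmem w hw
  exact ⟨l, f, hf, by rw [hfw, ← hwz, add_sub_cancel_right]⟩

variable {C} in
/-- There is at most one place above a nonsingular point. -/
theorem IsNonsingularPoint.eq_of_takesValue (hn : n ≠ 0) {P : Fin n → k}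
    (hP : C.IsNonsingularPoint P) {V W : ValuationSubring C.FunField}
    (hV : IsConstPlace (AlgebraicClosure k) V) (hW : IsConstPlace (AlgebraicClosure k) W)
    (hVP : ∀ i, TakesValue V (C.xcoord i) (algebraMap k (AlgebraicClosure k) (P i)))
    (hWP : ∀ i, TakesValue W (C.xcoord i) (algebraMap k (AlgebraicClosure k) (P i))) :
    V = W := by
  obtain ⟨j, hj⟩ := hP.exists_gradient_eq hn
  have hj' : ∀ i, ∃ l : AlgebraicClosure k, ∃ f ∈ C.idealBar,
      (fun r => eval (fun i => algebraMap k (AlgebraicClosure k) (P i)) (pderiv r f)) =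
        (Pi.single i 1 - l • Pi.single j 1 : Fin n → AlgebraicClosure k) := by
    intro i
    obtain ⟨l, f, hf, h⟩ := hj i
    refine ⟨algebraMap k _ l, MvPolynomial.map (algebraMap k (AlgebraicClosure k)) f,
      Ideal.mem_map_of_mem _ hf, ?_⟩
    ext r
    rw [pderiv_map, eval_map]
    have h1 := MvPolynomial.eval₂_comp_left (algebraMap k (AlgebraicClosure k)) (RingHom.id k) P
      (pderiv r f)
    rw [RingHom.comp_id] at h1
    refine h1.symm.trans ?_
    rw [MvPolynomial.eval₂_id, congrFun h r]
    simp [Pi.single_apply, apply_ite (algebraMap k (AlgebraicClosure k))]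
    rw [Algebra.algebraMap_eq_smul_one]
  have hval : ∀ a b : MvPolynomial (Fin n) (AlgebraicClosure k), ∃ c d,
      eval (fun i => algebraMap k (AlgebraicClosure k) (P i)) d ≠ 0 ∧
        (aeval C.xcoord (a * d - b * c) = 0 ∨ aeval C.xcoord (b * d - a * c) = 0) := by
    intro a b
    obtain ⟨c, d, hd, h⟩ := exists_mul_sub_mul_mem_of_jacobian C.idealBar _
      (fun f hf => hP.1.eval_eq_zero hf) j hj' a b
    exact ⟨c, d, hd, h.imp C.aeval_xcoord_eq_zero C.aeval_xcoord_eq_zero⟩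
  exact le_antisymm (hV.le_of_point hW C.exists_eq_aeval_div_aeval hval hVP hWP)
    (hW.le_of_point hV C.exists_eq_aeval_div_aeval hval hWP hVP)

variable {C} in
/-- There is a place above each point, as soon as some coordinate function is not constant. -/
theorem OnCurve.exists_takesValue {P : Fin n → k} (hP : C.OnCurve P)
    (hnc : ∃ i, ∀ a, C.xcoord i ≠ C.constMap a) :
    ∃ V : ValuationSubring C.FunField, IsConstPlace (AlgebraicClosure k) V ∧
      ∀ i, TakesValue V (C.xcoord i) (algebraMap k (AlgebraicClosure k) (P i)) := by
  set f : MvPolynomial (Fin n) (AlgebraicClosure k) →+* C.FunField :=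
    (algebraMap C.CoordRing C.FunField).comp (Ideal.Quotient.mk C.idealBar) with hf
  set φ := eval (fun i => algebraMap k (AlgebraicClosure k) (P i)) with hφ
  obtain ⟨V, hV, hlt⟩ := exists_valuationSubring_dominating f (RingHom.ker φ)
    (RingHom.ker_ne_top φ) (by
      intro x hx
      rw [RingHom.mem_ker, hf, RingHom.comp_apply, FaithfulSMul.algebraMap_eq_zero_iff,
        Ideal.Quotient.eq_zero_iff_mem] at hx
      exact hP.eval_eq_zero hx)
  have hval : ∀ i, TakesValue V (C.xcoord i) (algebraMap k (AlgebraicClosure k) (P i)) := by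
    intro i
    have := hlt (X i - MvPolynomial.C (algebraMap k (AlgebraicClosure k) (P i)))
      (by rw [RingHom.mem_ker, map_sub, eval_X, eval_C, sub_self])
    rw [map_sub] at this
    exact this
  refine ⟨V, ⟨fun a => hV (MvPolynomial.C a), ?_⟩, hval⟩
  rintro rfl
  obtain ⟨i, hi⟩ := hnc
  have h0 : C.xcoord i - C.constMap (algebraMap k (AlgebraicClosure k) (P i)) ≠ 0 :=
    sub_ne_zero.2 (hi _)
  have h1 := hval i
  rw [TakesValue, algebraMap_eq_constMap] at h1
  have h2 := (ValuationSubring.valuation_le_one_iff (⊤ : ValuationSubring C.FunField)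
    (C.xcoord i - C.constMap (algebraMap k (AlgebraicClosure k) (P i)))⁻¹).2 trivial
  rw [map_inv₀] at h2
  have h3 := (Valuation.ne_zero_iff (⊤ : ValuationSubring C.FunField).valuation).2 h0
  exact absurd h2 (not_le.2 ((one_lt_inv₀ (zero_lt_iff.2 h3)).2 h1))

end AffineCurve

section Parametrization

open Polynomial IntermediateField

/-- If `x` is the Laurent polynomial `p / s ^ m` in `s`, its value at a place is the value of this
Laurent polynomial. -/
theorem IsConstPlace.takesValue_of_mul_pow_eq {k F : Type*} [Field k] [Field F] [Algebra k F]
    {V : ValuationSubring F} (hV : IsConstPlace k V) {s x : F} {c e : k} (h : TakesValue V s c)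
    (hc : c ≠ 0) {p : k[X]} {m : ℕ} (hx : x * s ^ m = aeval s p) (he : e * c ^ m = p.eval c) :
    TakesValue V x e := by
  have h1 := hV.takesValue_aeval h (p - C e * X ^ m)
  rw [eval_sub, eval_mul, eval_C, eval_pow, eval_X, he, sub_self, TakesValue, map_zero, sub_zero,
    map_sub, map_mul, aeval_C, map_pow, aeval_X, ← hx, ← sub_mul, map_mul, map_pow,
    hV.valuation_eq_one_of_takesValue h hc, one_pow, mul_one] at h1
  exact h1

/-- Two automorphisms that act nontrivially on a quadratic subextension differ by one that acts
trivially. -/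
theorem IntermediateField.symm_apply_eq_of_finrank_eq_two {k E : Type*} [Field k] [Field E]
    [CharZero k] [Algebra k E] [Normal k E] {L : IntermediateField k E}
    (hL : Module.finrank k L = 2) {τ τ' : Gal(E/k)} (hτ : ∃ a ∈ L, τ a ≠ a)
    (hτ' : ∃ a ∈ L, τ' a ≠ a) {a : E} (ha : a ∈ L) : τ.symm (τ' a) = a := by
  have : FiniteDimensional k L := Module.finite_of_finrank_pos (by omega)
  have : Algebra.IsQuadraticExtension k L := ⟨hL⟩
  have : IsGalois k L := inferInstance
  have hcard : Nat.card Gal(L/k) = 2 := by rw [IsGalois.card_aut_eq_finrank, hL]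
  have hne : ∀ ρ : Gal(E/k), (∃ a ∈ L, ρ a ≠ a) → ρ.restrictNormal L ≠ 1 := by
    rintro ρ ⟨b, hb, hρb⟩ h1
    apply hρb
    have := ρ.restrictNormal_commutes L ⟨b, hb⟩
    rw [h1] at this
    exact this.symm
  have heq : τ.restrictNormal L = τ'.restrictNormal L := by
    obtain ⟨x, y, hxy, huniv⟩ := Nat.card_eq_two_iff.1 hcard
    have h1 := huniv.symm ▸ Set.mem_univ (1 : Gal(L/k))
    have h2 := huniv.symm ▸ Set.mem_univ (τ.restrictNormal L)
    have h3 := huniv.symm ▸ Set.mem_univ (τ'.restrictNormal L)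
    have := hne τ hτ
    have := hne τ' hτ'
    simp only [Set.mem_insert_iff, Set.mem_singleton_iff] at h1 h2 h3
    grind
  have e := τ.restrictNormal_commutes L ⟨a, ha⟩
  rw [heq, τ'.restrictNormal_commutes L ⟨a, ha⟩] at e
  change τ' a = τ a at e
  rw [e, AlgEquiv.symm_apply_apply]

namespace AffineCurve

/-- A genus `0` curve with two points at infinity, conjugate over `k` and defined over the
quadratic extension `L`, is parametrized by Laurent polynomials: every value of the parameter
that behaves like a norm `1` element of `L` yields a `k`-rational point, the value `1` being
sent to a prescribed nonsingular point. -/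
theorem exists_parametrization {k : Type} [Field k] [CharZero k] {n : ℕ} (C : AffineCurve k n)
    (hgenus : C.GenusZero) {A B : ValuationSubring C.FunField} (hAB : A ≠ B)
    (hinf : ∀ V, C.IsPointAtInfinity V ↔ V = A ∨ V = B)
    {L : IntermediateField k (AlgebraicClosure k)} (hL : Module.finrank k L = 2)
    (hdefA : C.DefinedOver L A) (hdefB : C.DefinedOver L B) (hconj : C.ConjugateOverK A B)
    {P : Fin n → k} (hP : C.IsNonsingularPoint P) :
    ∃ (p : Fin n → (AlgebraicClosure k)[X]) (m : Fin n → ℕ),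
      (∀ i, (p i).eval 1 = algebraMap k _ (P i)) ∧ (∃ i, ∀ y, p i ≠ Polynomial.C y * X ^ m i) ∧
      ∀ η : AlgebraicClosure k, η ≠ 0 →
        (∀ τ : Gal(AlgebraicClosure k/k), (∀ a ∈ L, τ a = a) → τ η = η) →
        (∀ τ : Gal(AlgebraicClosure k/k), (∃ a ∈ L, τ a ≠ a) → τ η = η⁻¹) →
        ∃ Q : Fin n → k, C.OnCurve Q ∧ ∀ i, algebraMap k _ (Q i) * η ^ m i = (p i).eval η := by
  obtain ⟨hApl, i₀, hi₀⟩ := (hinf A).2 (Or.inl rfl)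
  have hA := C.isConstPlace_of_isPlace hApl
  have hB := C.isConstPlace_of_isPlace ((hinf B).2 (Or.inr rfl)).1
  have hn : n ≠ 0 := by
    rintro rfl
    exact i₀.elim0
  have hx : ∀ V, IsConstPlace (AlgebraicClosure k) V → V ≠ A → V ≠ B → ∀ i, C.xcoord i ∈ V := by
    intro V hV hVA hVB i
    by_contra h
    rcases (hinf V).1 ⟨C.isPlace_of_isConstPlace hV, i, h⟩ with h | h
    · exact hVA h
    · exact hVB h
  have hnc : ∀ a, C.xcoord i₀ ≠ C.constMap a := fun a h => hi₀ (h ▸ hA.const_mem a)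
  obtain ⟨t, ht⟩ := hgenus.exists_adjoin_eq_top
  obtain ⟨V₁, hV₁, hV₁P⟩ := hP.1.exists_takesValue ⟨i₀, hnc⟩
  obtain ⟨s, hs, hone⟩ : ∃ s, IsPoleZeroGenerator (AlgebraicClosure k) A B s ∧
      TakesValue V₁ s (1 : AlgebraicClosure k) := by
    obtain ⟨s, hs⟩ := hA.exists_isPoleZeroGenerator hB hAB ht
    have hV₁A : V₁ ≠ A := by
      rintro rfl
      exact hi₀ (hV₁.mem_of_takesValue (hV₁P i₀))
    have hV₁B : V₁ ≠ B := by
      rintro rfl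
      obtain ⟨-, i, hi⟩ := (hinf V₁).2 (Or.inr rfl)
      exact hi (hV₁.mem_of_takesValue (hV₁P i))
    obtain ⟨c, hc, hcs⟩ := hs.exists_takesValue hV₁ hV₁A hV₁B
    refine ⟨_, hs.algebraMap_mul (inv_ne_zero hc), ?_⟩
    have := hV₁.takesValue_aeval hcs (Polynomial.C c⁻¹ * X)
    simpa [hc] using this
  have hgen := hs.adjoin_eq_top
  have hpm : ∀ i, ∃ (p : (AlgebraicClosure k)[X]) (m : ℕ), C.xcoord i * s ^ m = aeval s p :=
    fun i => hA.exists_mul_pow_eq_aeval hgen fun W c hW hWc hc =>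
      hx W hW (hs.ne_of_takesValue hWc hc).1 (hs.ne_of_takesValue hWc hc).2 i
  choose p m hpm using hpm
  have hvalue : ∀ {V : ValuationSubring C.FunField} {η : AlgebraicClosure k},
      IsConstPlace (AlgebraicClosure k) V → TakesValue V s η → η ≠ 0 → ∀ i,
      TakesValue V (C.xcoord i) ((p i).eval η / η ^ m i) := fun hV hη h0 i =>
    hV.takesValue_of_mul_pow_eq hη h0 (hpm i) (div_mul_cancel₀ _ (pow_ne_zero _ h0))
  obtain ⟨σ₀, hσ₀, hσ₀A, hσ₀B⟩ := hconj
  obtain ⟨τ₀, hτ₀⟩ := hσ₀.exists_restriction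
  have hτ₀L : ∃ a ∈ L, τ₀ a ≠ a := by
    by_contra! h
    refine hAB ((hdefA σ₀ ⟨fun a => ?_, hσ₀.2⟩).symm.trans hσ₀A)
    rw [hτ₀, h a a.2]
  refine ⟨p, m, fun i => ?_, ⟨i₀, fun y hy => ?_⟩, fun η hη0 hηL hηL' => ?_⟩
  · have := hV₁.takesValue_unique (hvalue hV₁ hone one_ne_zero i) (hV₁P i)
    simpa using this
  · have h1 := hpm i₀
    rw [hy, map_mul, aeval_C, map_pow, aeval_X] at h1
    exact hnc y (mul_right_cancel₀ (pow_ne_zero _ hs.ne_zero) h1)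
  obtain ⟨V, hV, hVη⟩ := hA.exists_isConstPlace_takesValue hgen η
  have hfix : ∀ (τ : Gal(AlgebraicClosure k/k)) (i : Fin n),
      τ ((p i).eval η / η ^ m i) = (p i).eval η / η ^ m i := by
    intro τ i
    obtain ⟨σ, hσ, hσx⟩ := C.exists_extension τ
    have hσV₁ : V₁.comap σ.toRingHom = V₁ := by
      refine hP.eq_of_takesValue hn (hV₁.comap hσ) hV₁ (fun i => ?_) hV₁P
      rw [takesValue_comap_iff hσ, hσx, AlgEquiv.commutes]
      exact hV₁P i
    have hVσ : V.comap σ.toRingHom = V := by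
      refine (hV.comap hσ).eq_of_takesValue hV hgen ?_ hVη
      rw [takesValue_comap_iff hσ]
      by_cases hτ : ∀ a ∈ L, τ a = a
      · have hσL : C.FixesLC L σ := ⟨fun a => by rw [hσ, hτ a a.2], hσx⟩
        rw [hηL τ hτ, hs.apply_eq_self hV₁ hone (τ := τ.toEquiv) (map_one τ) hσ (hdefA σ hσL)
          (hdefB σ hσL) hσV₁]
        exact hVη
      · push Not at hτ
        have hσL : C.FixesLC L (σ.trans σ₀.symm) := by
          refine ⟨fun a => ?_, fun i => ?_⟩
          · rw [RingEquiv.trans_apply, hσ, RingEquiv.symm_apply_eq, hτ₀]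
            congr 1
            rw [← AlgEquiv.symm_apply_eq]
            exact IntermediateField.symm_apply_eq_of_finrank_eq_two hL hτ₀L hτ a.2
          · rw [RingEquiv.trans_apply, hσx, RingEquiv.symm_apply_eq, hσ₀.2]
        have hswap : ∀ W W' : ValuationSubring C.FunField, W.comap σ₀.toRingHom = W' →
            W'.comap (σ.trans σ₀.symm).toRingHom = W' → W.comap σ.toRingHom = W' := by
          intro W W' h h'
          refine Eq.trans ?_ h'
          rw [← h]
          ext x
          simp [ValuationSubring.mem_comap]
        rw [hηL' τ hτ, hs.apply_eq_inv hV₁ hone (τ := τ.toEquiv) (map_one τ) hσ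
          (hswap A B hσ₀A (hdefB _ hσL)) (hswap B A hσ₀B (hdefA _ hσL)) hσV₁]
        refine hV.takesValue_of_mul_pow_eq (p := 1) (m := 1) hVη hη0 ?_ ?_
        · rw [pow_one, inv_mul_cancel₀ hs.ne_zero, map_one]
        · rw [pow_one, inv_mul_cancel₀ hη0, eval_one]
    have h1 := hvalue hV hVη hη0 i
    have h2 := h1
    rw [← hVσ, takesValue_comap_iff hσ, hσx] at h2
    exact hV.takesValue_unique h2 h1
  have hQ : ∀ i, ∃ q : k, algebraMap k _ q = (p i).eval η / η ^ m i := fun i =>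
    (InfiniteGalois.mem_range_algebraMap_iff_fixed _).2 fun τ => hfix τ i
  choose Q hQ using hQ
  refine ⟨Q, fun f hf => ?_, fun i => ?_⟩
  · have h1 := hV.takesValue_mvAeval (hvalue hV hVη hη0)
      (MvPolynomial.map (algebraMap k (AlgebraicClosure k)) f)
    rw [C.aeval_xcoord_eq_zero (Ideal.mem_map_of_mem _ hf)] at h1
    have h2 : TakesValue V (0 : C.FunField) (0 : AlgebraicClosure k) := by
      simp [TakesValue]
    have h3 := hV.takesValue_unique h1 h2
    rw [← funext hQ, MvPolynomial.eval_map] at h3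
    have h4 := MvPolynomial.eval₂_comp_left (algebraMap k (AlgebraicClosure k)) (RingHom.id k) Q f
    rw [RingHom.comp_id, MvPolynomial.eval₂_id] at h4
    rw [← map_eq_zero (algebraMap k (AlgebraicClosure k)), h4]
    exact h3
  · rw [hQ, div_mul_cancel₀ _ (pow_ne_zero _ hη0)]

end AffineCurve

end Parametrization

section Integrality

open Polynomial

/-- Finitely many polynomials over an algebraic extension of a number field have a common
denominator. -/
theorem NumberField.exists_int_mul_coeff_isIntegral {E : Type*} [Field E] [Algebra K E]
    [Algebra.IsAlgebraic K E] {ι : Type*} [Finite ι] (p : ι → E[X]) :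
    ∃ d : ℤ, d ≠ 0 ∧ ∀ i j, IsIntegral ℤ (d * (p i).coeff j) := by
  classical
  have := Fintype.ofFinite ι
  have : CharZero E := charZero_of_injective_algebraMap (algebraMap K E).injective
  have : Algebra.IsAlgebraic ℚ E := Algebra.IsAlgebraic.trans ℚ K E
  have : Algebra.IsAlgebraic ℤ E :=
    (IsFractionRing.comap_isAlgebraic_iff (A := ℤ) (K := ℚ)).2 inferInstance
  obtain ⟨d, hd, h⟩ := Algebra.IsAlgebraic.exists_integral_multiples ℤ
    (Finset.univ.biUnion fun i => (p i).support.image (p i).coeff)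
  refine ⟨d, hd, fun i j => ?_⟩
  by_cases hj : (p i).coeff j = 0
  · rw [hj, mul_zero]
    exact isIntegral_zero
  · rw [← zsmul_eq_mul]
    exact h _ (Finset.mem_biUnion.2 ⟨i, Finset.mem_univ i, Finset.mem_image_of_mem _
      (mem_support_iff.2 hj)⟩)

theorem Polynomial.eval_sub_eval_one_mem {E : Type*} [Field E] (T : Subring E) {p : E[X]} {d ζ y : E}
    (hp : ∀ j, d * p.coeff j ∈ T) (hζ : ζ ∈ T) (hy : y ∈ T) (hζy : ζ - 1 = d * y) :
    p.eval ζ - p.eval 1 ∈ T := by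
  rw [eval_eq_sum_range, eval_eq_sum_range, ← Finset.sum_sub_distrib]
  refine T.sum_mem fun j _ => ?_
  have : p.coeff j * ζ ^ j - p.coeff j * 1 ^ j =
      d * p.coeff j * (y * ∑ i ∈ Finset.range j, ζ ^ i) := by
    have h1 := mul_geom_sum ζ j
    rw [hζy] at h1
    rw [one_pow, ← mul_sub, ← h1]
    ring
  rw [this]
  exact T.mul_mem (hp j) (T.mul_mem hy (T.sum_mem fun i _ => T.pow_mem hζ i))

end Integrality

/-- If `C` has genus `0` and exactly two points at infinity, conjugate over `K` with
quadratic field of definition `L`, some `v ∈ S` splits in `L`, and `C` has a non-singular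
`S`-integral point, then `C` has infinitely many `S`-integral points. -/
theorem infinite_SIntegralPoints_of_two_conjugate_points_at_infinity
    (K : Type) [Field K] [NumberField K] (n : ℕ) (C : AffineCurve K n)
    (S : Finset (NFPlace K)) (hS : ∀ v : NumberField.InfinitePlace K, Sum.inl v ∈ S)
    (hgenus : C.GenusZero)
    (A B : ValuationSubring C.FunField) (hAB : A ≠ B)
    (hinf : ∀ V, C.IsPointAtInfinity V ↔ V = A ∨ V = B)
    (L : IntermediateField K (AlgebraicClosure K)) (hL : Module.finrank K L = 2)
    (hdefA : C.DefinedOver L A) (hdefB : C.DefinedOver L B)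
    (hconj : C.ConjugateOverK A B)
    (hsplit : ∃ v ∈ S, SplitsIn K L v)
    (hP : ∃ P ∈ C.SIntegralPoints S, C.IsNonsingularPoint P) :
    (C.SIntegralPoints S).Infinite := by
  classical
  obtain ⟨P, ⟨hPC, hPS⟩, hPns⟩ := hP
  obtain ⟨p, m, hp1, ⟨i₀, hi₀⟩, hpar⟩ :=
    C.exists_parametrization hgenus hAB hinf hL hdefA hdefB hconj hPns
  obtain ⟨η, hη0, hηg, hη1, hηint, hηint', hηd⟩ := exists_norm_one_unit_of_splitsIn hL hsplit
  obtain ⟨d, hd, hdp⟩ := NumberField.exists_int_mul_coeff_isIntegral K p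
  obtain ⟨N, hN, y, hy, hNy⟩ := hηd d hd
  let T : Subring (AlgebraicClosure K) :=
    (integralClosure (SIntegers K S) (AlgebraicClosure K)).toSubring
  have hT : ∀ x : L, IsIntegral (SIntegers K S) x → (x : AlgebraicClosure K) ∈ T := fun x hx =>
    hx.map (L.val.restrictScalars (SIntegers K S))
  have hdT : ∀ i j, (d : AlgebraicClosure K) * (p i).coeff j ∈ T := fun i j =>
    (hdp i j).tower_top
  have hgalois : ∀ τ : Gal(AlgebraicClosure K/K), (∃ a ∈ L, τ a ≠ a) →
      τ (η : AlgebraicClosure K) = (η : AlgebraicClosure K)⁻¹ := by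
    have : FiniteDimensional K L := Module.finite_of_finrank_pos (by omega)
    have : Algebra.IsQuadraticExtension K L := ⟨hL⟩
    rintro τ ⟨a, ha, hτa⟩
    have hne : τ.restrictNormal L ≠ 1 := by
      intro h1
      apply hτa
      have := τ.restrictNormal_commutes L ⟨a, ha⟩
      rw [h1] at this
      exact this.symm
    have := τ.restrictNormal_commutes L η
    rw [hηg _ hne] at this
    exact this.symm
  let ζ : ℕ → L := fun j => η ^ (N * j)
  have hζ0 : ∀ j, ζ j ≠ 0 := fun j => pow_ne_zero _ hη0
  have hζinj : Function.Injective ζ := by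
    have key : ∀ i j : ℕ, i < j → ζ i ≠ ζ j := by
      intro i j hij h
      obtain ⟨l, rfl⟩ := Nat.exists_eq_add_of_lt hij
      refine hη1 (N * (l + 1)) (mul_ne_zero hN l.succ_ne_zero) ?_
      have e : ζ (i + l + 1) = ζ i * η ^ (N * (l + 1)) := by
        simp only [ζ]
        ring
      rw [e] at h
      exact (mul_eq_left₀ (hζ0 i)).1 h.symm
    intro i j h
    by_contra hne
    rcases lt_or_gt_of_ne hne with h' | h'
    · exact key i j h' h
    · exact key j i h' h.symm
  have hpoint : ∀ j, ∃ Q ∈ C.SIntegralPoints S, ∀ i,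
      algebraMap K (AlgebraicClosure K) (Q i) * (ζ j : AlgebraicClosure K) ^ m i =
        (p i).eval (ζ j : AlgebraicClosure K) := by
    intro j
    have hζ0' : (ζ j : AlgebraicClosure K) ≠ 0 := by exact_mod_cast hζ0 j
    obtain ⟨Q, hQ, hQe⟩ := hpar (ζ j) hζ0' (fun τ hτ => hτ _ (ζ j).2) (fun τ hτ => by
      simp only [ζ, IntermediateField.coe_pow, map_pow, hgalois τ hτ, inv_pow])
    refine ⟨Q, ⟨hQ, fun i => mem_SIntegers_of_isIntegral ?_⟩, hQe⟩
    rw [← isIntegral_algebraMap_iff (FaithfulSMul.algebraMap_injective K (AlgebraicClosure K))]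
    have hζT : (ζ j : AlgebraicClosure K) ∈ T := hT _ (hηint.pow _)
    have hζT' : (ζ j : AlgebraicClosure K)⁻¹ ∈ T := by
      have := hT _ (hηint'.pow (N * j))
      rwa [inv_pow, IntermediateField.coe_inv] at this
    have hcong : (ζ j : AlgebraicClosure K) - 1 =
        d * ((y * ∑ i ∈ Finset.range j, (η ^ N) ^ i : L) : AlgebraicClosure K) := by
      have : ζ j - 1 = d * (y * ∑ i ∈ Finset.range j, (η ^ N) ^ i) := by
        rw [← mul_assoc, ← hNy, mul_geom_sum, ← pow_mul]
      exact_mod_cast congrArg (fun x : L => (x : AlgebraicClosure K)) this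
    have h1 := Polynomial.eval_sub_eval_one_mem T (hdT i) hζT
      (hT _ (hy.mul (IsIntegral.sum _ fun i _ => (hηint.pow N).pow i))) hcong
    have h2 : (p i).eval 1 ∈ T := by
      rw [hp1]
      exact isIntegral_algebraMap (R := SIntegers K S) (x := ⟨P i, hPS i⟩)
    have h3 : (p i).eval (ζ j : AlgebraicClosure K) ∈ T := by
      simpa using T.add_mem h1 h2
    have h4 : algebraMap K (AlgebraicClosure K) (Q i) =
        (p i).eval (ζ j : AlgebraicClosure K) * (ζ j : AlgebraicClosure K)⁻¹ ^ m i := by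
      rw [← hQe i, mul_assoc, ← mul_pow, mul_inv_cancel₀ hζ0', one_pow, mul_one]
    rw [h4]
    exact T.mul_mem h3 (T.pow_mem hζT' _)
  choose Q hQS hQ using hpoint
  intro hfin
  have := hfin.to_subtype
  obtain ⟨R, hR⟩ := Finite.exists_infinite_fiber
    (fun j => (⟨Q j, hQS j⟩ : C.SIntegralPoints S))
  refine hi₀ (algebraMap K _ (R.1 i₀)) (sub_eq_zero.1 (Polynomial.eq_zero_of_infinite_isRoot _ ?_))
  refine ((Set.infinite_coe_iff.1 hR).image
    (f := fun j => (ζ j : AlgebraicClosure K)) ?_).mono ?_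
  · exact (Subtype.val_injective.comp hζinj).injOn
  · rintro _ ⟨j, hj, rfl⟩
    have hRj : Q j = R.1 := congrArg Subtype.val hj
    simp only [Set.mem_ofPred_eq, Polynomial.IsRoot.def, Polynomial.eval_sub, Polynomial.eval_mul,
      Polynomial.eval_C, Polynomial.eval_pow, Polynomial.eval_X]
    rw [← hRj, hQ, sub_self]
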